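/- arXiv:nlin/0012063 — 11 statements merged into one kernel-verified Lean document; each statement's English description precedes it below -/
import Mathlib

section
/- For each i ∈ ℤ/3ℤ, the Bäcklund transformation s_i of the q-Painlevé IV symmetric form is an involution: if a = (a₀,a₁,a₂) ∈ (ℂ∖{0})³ and f = (f₀,f₁,f₂) ∈ ℂ³ satisfy 1 + a_i f_i ≠ 0 and a_i + f_i ≠ 0, then applying s_i twice returns (a,f), i.e. s_i(s_i(a,f)) = (a,f). -/
noncomputable section

/-- The type `A₂⁽¹⁾` generalized Cartan matrix. -/
def cartanA2 (i j : ZMod 3) : ℤ := if i = j then 2 else -1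

/-- An orientation matrix of the `A₂⁽¹⁾` Dynkin diagram. -/
def orientA2 (i j : ZMod 3) : ℤ := if i = j then 0 else if j = i + 1 then 1 else -1

/-- The Bäcklund transformation `sᵢ` of the symmetric form of q-Painlevé IV. -/
def sBT (i : ZMod 3) (p : (ZMod 3 → ℂ) × (ZMod 3 → ℂ)) : (ZMod 3 → ℂ) × (ZMod 3 → ℂ) :=
  (fun j => p.1 j * p.1 i ^ (-(cartanA2 i j)),
   fun j => p.2 j * ((p.1 i + p.2 i) / (1 + p.1 i * p.2 i)) ^ (orientA2 i j))

theorem sBT_fst_self (i : ZMod 3) (p : (ZMod 3 → ℂ) × (ZMod 3 → ℂ)) (h : p.1 i ≠ 0) :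
    (sBT i p).1 i = (p.1 i)⁻¹ := by
  simp only [sBT, cartanA2, if_true]
  rw [zpow_neg, zpow_ofNat]
  field_simp

theorem sBT_snd_self (i : ZMod 3) (p : (ZMod 3 → ℂ) × (ZMod 3 → ℂ)) :
    (sBT i p).2 i = p.2 i := by
  simp [sBT, orientA2]

theorem sBT_involutive (i : ZMod 3) (a f : ZMod 3 → ℂ)
    (ha : ∀ j, a j ≠ 0)
    (h1 : 1 + a i * f i ≠ 0) (h2 : a i + f i ≠ 0) :
    sBT i (sBT i (a, f)) = (a, f) := by
  have hs : ((a i)⁻¹ + f i) / (1 + (a i)⁻¹ * f i) = ((a i + f i) / (1 + a i * f i))⁻¹ := by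
    have hi := ha i
    have e : (a i)⁻¹ + f i = (1 + a i * f i) / a i := by field_simp
    have e' : 1 + (a i)⁻¹ * f i = (a i + f i) / a i := by field_simp
    rw [e, e', div_div_div_cancel_right₀ hi, inv_div]
  have ha' := sBT_fst_self i (a, f) (ha i)
  have hf' := sBT_snd_self i (a, f)
  rw [sBT, ha', hf']
  refine Prod.ext (funext fun j => ?_) (funext fun j => ?_)
  · simp only [sBT]
    rw [inv_zpow, mul_inv_cancel_right₀ (zpow_ne_zero _ (ha i))]
  · simp only [sBT]
    rw [hs, inv_zpow, mul_inv_cancel_right₀ (zpow_ne_zero _ (div_ne_zero h2 h1))]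

end
end

section
/- The map r given by r(f₀,f₁,f₂) = (f₂/(a₀a₁) · (a₀a₁ + a₀f₁ + f₀f₁)/(a₂a₀ + a₂f₀ + f₂f₀), f₀/(a₁a₂) · (a₁a₂ + a₁f₂ + f₁f₂)/(a₀a₁ + a₀f₁ + f₀f₁), f₁/(a₂a₀) · (a₂a₀ + a₂f₀ + f₂f₀)/(a₁a₂ + a₁f₂ + f₁f₂)) is the inverse of the qP_IV time evolution t: for all a = (a₀,a₁,a₂) ∈ (ℂ∖{0})³ and f = (f₀,f₁,f₂) ∈ ℂ³ such that all denominators appearing in t and in r applied to t(a,f) are nonzero, applying r to the f-components of t(a,f) (with the same parameters a) returns (f₀,f₁,f₂). -/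
noncomputable section

/-- The `j`-th denominator arising in the time evolution of q-Painlevé IV. -/
def tDen (p : (ZMod 3 → ℂ) × (ZMod 3 → ℂ)) (j : ZMod 3) : ℂ :=
  1 + p.1 j * p.2 j + p.1 j * p.1 (j + 1) * p.2 j * p.2 (j + 1)

/-- The discrete time evolution `t` of the symmetric form of q-Painlevé IV. -/
def tEv (p : (ZMod 3 → ℂ) × (ZMod 3 → ℂ)) : (ZMod 3 → ℂ) × (ZMod 3 → ℂ) :=
  (p.1, fun j => p.1 j * p.1 (j + 1) * p.2 (j + 1) *
    (1 + p.1 (j + 2) * p.2 (j + 2) + p.1 (j + 2) * p.1 j * p.2 (j + 2) * p.2 j) /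
    tDen p j)

/-- The candidate inverse `r` of the time evolution (acting on the `f`-components,
with parameters `a`):
`r(f)ⱼ = f_{j+2}/(aⱼa_{j+1}) ⬝ (aⱼa_{j+1} + aⱼf_{j+1} + fⱼf_{j+1})/(a_{j+2}aⱼ + a_{j+2}fⱼ + f_{j+2}fⱼ)`. -/
def rInv (a g : ZMod 3 → ℂ) (j : ZMod 3) : ℂ :=
  g (j + 2) / (a j * a (j + 1)) *
    ((a j * a (j + 1) + a j * g (j + 1) + g j * g (j + 1)) /
      (a (j + 2) * a j + a (j + 2) * g j + g (j + 2) * g j))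

theorem zmod_three_add (j : ZMod 3) :
    j + 1 + 1 = j + 2 ∧ j + 1 + 2 = j ∧ j + 2 + 1 = j ∧ j + 2 + 2 = j + 1 := by
  revert j
  decide

/-- The numerators and denominators in `r` become the denominators of `t` after
applying the time evolution. -/
theorem add_tEv_eq_mul_tDen (a f : ZMod 3 → ℂ) (h : ∀ j, tDen (a, f) j ≠ 0) (j : ZMod 3) :
    a j * a (j + 1) + a j * (tEv (a, f)).2 (j + 1)
      + (tEv (a, f)).2 j * (tEv (a, f)).2 (j + 1) = a j * a (j + 1) * tDen (a, f) (j + 2) := by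
  obtain ⟨e₁, e₂, e₃, -⟩ := zmod_three_add j
  have h₀ := h j
  have h₁ := h (j + 1)
  have hg₀ : (tEv (a, f)).2 j
      = a j * a (j + 1) * f (j + 1) * tDen (a, f) (j + 2) / tDen (a, f) j := by
    simp only [tEv, tDen, e₃]
  have hg₁ : (tEv (a, f)).2 (j + 1)
      = a (j + 1) * a (j + 2) * f (j + 2) * tDen (a, f) j / tDen (a, f) (j + 1) := by
    simp only [tEv, tDen, e₁, e₂]
  rw [hg₀, hg₁]
  field_simp
  simp only [tDen, e₁, e₃]
  ring

theorem rInv_tEv (a f : ZMod 3 → ℂ)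
    (ha : ∀ j, a j ≠ 0)
    (h1 : ∀ j, tDen (a, f) j ≠ 0)
    (h2 : ∀ j, a (j + 2) * a j + a (j + 2) * (tEv (a, f)).2 j
            + (tEv (a, f)).2 (j + 2) * (tEv (a, f)).2 j ≠ 0) :
    ∀ j, rInv a (tEv (a, f)).2 j = f j := by
  intro j
  obtain ⟨e₁, -, e₃, e₄⟩ := zmod_three_add j
  have hN := add_tEv_eq_mul_tDen a f h1 (j + 2)
  rw [e₃, e₄] at hN
  have hg : (tEv (a, f)).2 (j + 2)
      = a (j + 2) * a j * f j * tDen (a, f) (j + 1) / tDen (a, f) (j + 2) := by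
    simp only [tEv, tDen, e₁, e₃, e₄]
  have a₀ := ha j
  have a₁ := ha (j + 1)
  have a₂ := ha (j + 2)
  have d₁ := h1 (j + 1)
  have d₂ := h1 (j + 2)
  rw [rInv, add_tEv_eq_mul_tDen a f h1 j, hN, hg]
  field_simp

end
end

section
/- Continuous limit of qP_IV to the symmetric form of P_IV: fix complex numbers α₀,α₁,α₂ and φ₀,φ₁,φ₂. For real ε, set a_i(ε) = exp(-ε²α_i/2) and f_i(ε) = -exp(-ε φ_i) for i ∈ ℤ/3ℤ, and let f̄_i(ε) denote the i-th component of the qP_IV time evolution applied to (a(ε), f(ε)) (which is defined for all ε sufficiently close to 0, since the denominators tend to 1). Then for each i ∈ ℤ/3ℤ, (f̄_i(ε) - f_i(ε))/ε² tends to φ_i(φ_{i+1} - φ_{i+2}) + α_i as ε → 0 (ε ≠ 0). -/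
noncomputable section

open Filter Topology in
/-- First-order behaviour of `exp (a z + b z ^ 2)` at the origin. -/
theorem tendsto_exp_quadratic_sub_one_div (a b : ℂ) :
    Tendsto (fun z : ℂ => (Complex.exp (a * z + b * z ^ 2) - 1) / z) (𝓝[≠] 0) (𝓝 a) := by
  have h : HasDerivAt (fun z : ℂ => Complex.exp (a * z + b * z ^ 2)) a 0 := by
    have h₁ : HasDerivAt (fun z : ℂ => a * z + b * z ^ 2) a 0 := by
      have h₂ := ((hasDerivAt_id' (0 : ℂ)).const_mul a).fun_add
        ((hasDerivAt_pow 2 (0 : ℂ)).const_mul b)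
      simpa using h₂
    simpa using h₁.cexp
  refine h.tendsto_slope.congr fun z => ?_
  simp [slope_def_field]

open Filter Topology in
/-- Second-order behaviour of `exp (c z ^ 2)` at the origin. -/
theorem tendsto_exp_mul_sq_sub_one_div_sq (c : ℂ) :
    Tendsto (fun z : ℂ => (Complex.exp (c * z ^ 2) - 1) / z ^ 2) (𝓝[≠] 0) (𝓝 c) := by
  have hsq : Tendsto (fun z : ℂ => z ^ 2) (𝓝[≠] 0) (𝓝[≠] 0) := by
    refine tendsto_nhdsWithin_iff.2 ⟨?_, ?_⟩
    · have : Tendsto (fun z : ℂ => z ^ 2) (𝓝 0) (𝓝 ((0 : ℂ) ^ 2)) :=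
        (continuous_pow 2).tendsto 0
      simpa using this.mono_left nhdsWithin_le_nhds
    · filter_upwards [self_mem_nhdsWithin] with z hz
      exact pow_ne_zero 2 hz
  simpa [Function.comp_def] using (tendsto_exp_quadratic_sub_one_div c 0).comp hsq

/-- Factorisation of `1 - E + E F` relative to `F`. -/
theorem one_sub_add_mul_eq (E : ℂ) {F : ℂ} (hF : F ≠ 0) :
    1 - E + E * F = F * (1 + (E - 1) * (1 - F⁻¹)) := by
  field_simp
  ring

open Filter Topology in
/-- Product of two first-order increments of exponentials, to second order. -/
theorem tendsto_exp_increment_product (a b c d : ℂ) :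
    Tendsto (fun z : ℂ => (Complex.exp (a * z + b * z ^ 2) - 1) *
      (1 - (Complex.exp (c * z + d * z ^ 2))⁻¹) / z ^ 2) (𝓝[≠] 0) (𝓝 (a * c)) := by
  have h := ((tendsto_exp_quadratic_sub_one_div a b).mul
    (tendsto_exp_quadratic_sub_one_div (-c) (-d))).neg
  rw [show -(a * -c) = a * c by ring] at h
  refine h.congr fun z => ?_
  rw [← Complex.exp_neg, show -(c * z + d * z ^ 2) = -c * z + -d * z ^ 2 by ring]
  ring

open Filter Topology in
/-- A function with a finite limit after division by `z ^ 2` tends to zero. -/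
theorem tendsto_zero_of_tendsto_div_sq {g : ℂ → ℂ} {l : ℂ}
    (h : Tendsto (fun z => g z / z ^ 2) (𝓝[≠] 0) (𝓝 l)) : Tendsto g (𝓝[≠] 0) (𝓝 0) := by
  have hsq : Tendsto (fun z : ℂ => z ^ 2) (𝓝[≠] 0) (𝓝 ((0 : ℂ) ^ 2)) :=
    ((continuous_pow 2).tendsto 0).mono_left nhdsWithin_le_nhds
  have h' := h.mul hsq
  rw [zero_pow two_ne_zero, mul_zero] at h'
  refine h'.congr' ?_
  filter_upwards [self_mem_nhdsWithin] with z hz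
  exact div_mul_cancel₀ _ (pow_ne_zero 2 hz)

open Filter Topology in
/-- The continuous limit along a complex parameter. -/
theorem tendsto_tEv_sub_div_sq (α φ : ZMod 3 → ℂ) (i : ZMod 3) :
    Tendsto
      (fun z : ℂ =>
        ((tEv (fun j => Complex.exp (-z ^ 2 * α j / 2),
               fun j => -Complex.exp (-z * φ j))).2 i
          - (-Complex.exp (-z * φ i))) / z ^ 2)
      (𝓝[≠] 0) (𝓝 (φ i * (φ (i + 1) - φ (i + 2)) + α i)) := by
  set E : ZMod 3 → ℂ → ℂ := fun j z => Complex.exp (-φ j * z + -α j / 2 * z ^ 2) with hE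
  set P : ℂ → ℂ := fun z => (E (i + 2) z - 1) * (1 - (E i z)⁻¹) with hP
  set Q : ℂ → ℂ := fun z => (E i z - 1) * (1 - (E (i + 1) z)⁻¹) with hQ
  have hP₂ : Tendsto (fun z => P z / z ^ 2) (𝓝[≠] 0) (𝓝 (-φ (i + 2) * -φ i)) :=
    tendsto_exp_increment_product _ _ _ _
  have hQ₂ : Tendsto (fun z => Q z / z ^ 2) (𝓝[≠] 0) (𝓝 (-φ i * -φ (i + 1))) :=
    tendsto_exp_increment_product _ _ _ _
  have hP₀ := tendsto_zero_of_tendsto_div_sq hP₂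
  have hQ₁ : Tendsto (fun z => 1 + Q z) (𝓝[≠] 0) (𝓝 1) := by
    simpa using (tendsto_zero_of_tendsto_div_sq hQ₂).const_add 1
  have hA := tendsto_exp_mul_sq_sub_one_div_sq (-α i)
  have he : Tendsto (fun z : ℂ => Complex.exp (-z * φ i)) (𝓝[≠] 0) (𝓝 1) := by
    have hc : Continuous fun z : ℂ => Complex.exp (-z * φ i) := by fun_prop
    simpa using (hc.tendsto 0).mono_left nhdsWithin_le_nhds
  have key := (he.neg.mul (((hA.mul (hP₀.const_add 1)).add hP₂).sub hQ₂)).div hQ₁ one_ne_zero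
  rw [show φ i * (φ (i + 1) - φ (i + 2)) + α i =
    -1 * (-α i * (1 + 0) + -φ (i + 2) * -φ i - -φ i * -φ (i + 1)) / 1 by ring]
  refine key.congr' ?_
  filter_upwards [self_mem_nhdsWithin, hQ₁.eventually_ne one_ne_zero] with z hz hQz
  have haf : ∀ j, Complex.exp (-z ^ 2 * α j / 2) * Complex.exp (-z * φ j) = E j z := by
    intro j
    rw [hE, ← Complex.exp_add]
    ring_nf
  have hAi : Complex.exp (-α i * z ^ 2) =
      Complex.exp (-z ^ 2 * α i / 2) * Complex.exp (-z ^ 2 * α i / 2) := by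
    rw [← Complex.exp_add]
    ring_nf
  have hE₀ : ∀ j, E j z ≠ 0 := fun j => Complex.exp_ne_zero _
  have hev : (tEv (fun j => Complex.exp (-z ^ 2 * α j / 2),
      fun j => -Complex.exp (-z * φ j))).2 i =
      -Complex.exp (-z * φ i) * Complex.exp (-α i * z ^ 2) * (1 + P z) / (1 + Q z) := by
    have hden : tDen (fun j => Complex.exp (-z ^ 2 * α j / 2),
        fun j => -Complex.exp (-z * φ j)) i = E (i + 1) z * (1 + Q z) := by
      rw [hQ, ← one_sub_add_mul_eq _ (hE₀ _), ← haf, ← haf, tDen]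
      ring
    have hnum : 1 + Complex.exp (-z ^ 2 * α (i + 2) / 2) * -Complex.exp (-z * φ (i + 2)) +
        Complex.exp (-z ^ 2 * α (i + 2) / 2) * Complex.exp (-z ^ 2 * α i / 2) *
          -Complex.exp (-z * φ (i + 2)) * -Complex.exp (-z * φ i) = E i z * (1 + P z) := by
      rw [hP, ← one_sub_add_mul_eq _ (hE₀ _), ← haf, ← haf]
      ring
    simp only [tEv]
    rw [hden, hnum, div_eq_div_iff (mul_ne_zero (hE₀ _) hQz) hQz, hAi, ← haf i, ← haf (i + 1)]
    ring
  have hz₂ : z ^ 2 ≠ 0 := pow_ne_zero 2 hz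
  rw [hev]
  simp only [Pi.div_apply]
  field_simp
  ring

/-- Continuous limit of qP_IV: with `aᵢ(ε) = exp(-ε²αᵢ/2)` and `fᵢ(ε) = -exp(-εφᵢ)`,
the difference quotient `(f̄ᵢ(ε) - fᵢ(ε))/ε²` tends to `φᵢ(φ_{i+1} - φ_{i+2}) + αᵢ`
as `ε → 0`, `ε ≠ 0`. -/
theorem qPIV_continuous_limit (α φ : ZMod 3 → ℂ) (i : ZMod 3) :
    Filter.Tendsto
      (fun ε : ℝ =>
        ((tEv (fun j => Complex.exp (-(ε : ℂ) ^ 2 * α j / 2),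
               fun j => -Complex.exp (-(ε : ℂ) * φ j))).2 i
          - (-Complex.exp (-(ε : ℂ) * φ i))) / (ε : ℂ) ^ 2)
      (nhdsWithin (0 : ℝ) {(0 : ℝ)}ᶜ)
      (nhds (φ i * (φ (i + 1) - φ (i + 2)) + α i)) := by
  have hof : Filter.Tendsto (fun ε : ℝ => (ε : ℂ)) (nhdsWithin 0 {0}ᶜ) (nhdsWithin 0 {0}ᶜ) := by
    refine tendsto_nhdsWithin_iff.2 ⟨?_, ?_⟩
    · simpa using (Complex.continuous_ofReal.tendsto 0).mono_left nhdsWithin_le_nhds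
    · filter_upwards [self_mem_nhdsWithin] with ε hε
      exact Complex.ofReal_ne_zero.2 hε
  exact (tendsto_tEv_sub_div_sq α φ i).comp hof

end
end

section
/- Let α₀,α₁,α₂ ∈ ℂ with α₀+α₁+α₂ = 1, and let φ₀,φ₁,φ₂ : ℝ → ℂ be differentiable functions with φ₀(t)+φ₁(t)+φ₂(t) = t for all t, satisfying the symmetric form of P_IV: φ₀' = φ₀(φ₁-φ₂)+α₀, φ₁' = φ₁(φ₂-φ₀)+α₁, φ₂' = φ₂(φ₀-φ₁)+α₂. Then y = φ₀ is twice differentiable, and at every point t where y(t) ≠ 0 it satisfies the fourth Painlevé equation y'' = (y')²/(2y) + (3/2)y³ - 2 t y² + (t²/2 + α₁ - α₂) y - α₀²/(2y). -/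
noncomputable section

/-- The symmetric form of P_IV implies the fourth Painlevé equation for `y = φ₀`. -/
theorem symPIV_to_PIV (α₀ α₁ α₂ : ℂ) (hα : α₀ + α₁ + α₂ = 1)
    (φ₀ φ₁ φ₂ : ℝ → ℂ)
    (hd0 : Differentiable ℝ φ₀) (hd1 : Differentiable ℝ φ₁) (hd2 : Differentiable ℝ φ₂)
    (hsum : ∀ t : ℝ, φ₀ t + φ₁ t + φ₂ t = (t : ℂ))
    (he0 : ∀ t : ℝ, deriv φ₀ t = φ₀ t * (φ₁ t - φ₂ t) + α₀)
    (he1 : ∀ t : ℝ, deriv φ₁ t = φ₁ t * (φ₂ t - φ₀ t) + α₁)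
    (he2 : ∀ t : ℝ, deriv φ₂ t = φ₂ t * (φ₀ t - φ₁ t) + α₂) :
    Differentiable ℝ (deriv φ₀) ∧
    ∀ t : ℝ, φ₀ t ≠ 0 →
      deriv (deriv φ₀) t =
        (deriv φ₀ t) ^ 2 / (2 * φ₀ t) + (3 / 2) * (φ₀ t) ^ 3 - 2 * (t : ℂ) * (φ₀ t) ^ 2
          + ((t : ℂ) ^ 2 / 2 + α₁ - α₂) * φ₀ t - α₀ ^ 2 / (2 * φ₀ t) := by
  have hderiv : ∀ t : ℝ, HasDerivAt (deriv φ₀)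
      (deriv φ₀ t * (φ₁ t - φ₂ t) + φ₀ t * (deriv φ₁ t - deriv φ₂ t)) t := by
    intro t
    have h := (((hd0 t).hasDerivAt.mul
      ((hd1 t).hasDerivAt.sub (hd2 t).hasDerivAt)).add_const α₀)
    exact h.congr_of_eventuallyEq (Filter.Eventually.of_forall he0)
  refine ⟨fun t => (hderiv t).differentiableAt, fun t ht => ?_⟩
  rw [(hderiv t).deriv, he0, he1, he2, ← hsum t]
  field_simp
  ring

end
end

section
/- Seed solution of qP_IV on a reflection hyperplane (Proposition: N = 0, a₂ = 1): let q, a₀ ∈ ℂ∖{0}, ν ∈ ℤ, and let G : ℤ × ℂ → ℂ satisfy the contiguity relations. Suppose G_ν(c) ≠ 0 and G_ν(qc) ≠ 0 for all relevant c. Define f₀(c) = c² a₀ q^ν G_ν(c)/G_ν(qc), f₁(c) = -(q/(a₀q^ν)) G_ν(qc)/G_ν(c), f₂(c) = -1. Then (f₀,f₁,f₂) satisfies the qP_IV system with parameters (ν, N=0, a₂=1), i.e. for all c ∈ ℂ at which the denominators below are nonzero: f₀(qc) = q f₁(c)(1 + f₂(c) + a₀q^ν f₂(c)f₀(c))/(1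 + a₀q^ν f₀(c) + q f₀(c)f₁(c)), f₁(qc) = (q^{1-ν}/a₀) f₂(c)(1 + a₀q^ν f₀(c) + q f₀(c)f₁(c))/(1 + (q^{1-ν}/a₀)f₁(c) + (q^{1-ν}/a₀)f₁(c)f₂(c)), and f₂(qc) = a₀q^ν f₀(c)(1 + (q^{1-ν}/a₀)f₁(c) + (q^{1-ν}/a₀)f₁(c)f₂(c))/(1 + f₂(c) + a₀q^ν f₂(c)f₀(c)). -/
noncomputable section

/-- Seed solution of qP_IV on a reflection hyperplane (`N = 0`, `a₂ = 1`). -/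
theorem qPIV_seed_solution (q a₀ : ℂ) (hq : q ≠ 0) (ha : a₀ ≠ 0) (ν : ℤ)
    (G : ℤ → ℂ → ℂ)
    (hc1 : ∀ (μ : ℤ) (c : ℂ), G (μ + 1) (q * c) = G μ (q * c) + a₀ ^ 2 * q ^ (2 * μ) * c ^ 2 * G μ c)
    (hc2 : ∀ (μ : ℤ) (c : ℂ), G (μ + 1) c = G μ (q * c) + c ^ 2 * G μ c)
    (f₀ f₁ f₂ : ℂ → ℂ)
    (hf0 : ∀ c, f₀ c = c ^ 2 * a₀ * q ^ ν * G ν c / G ν (q * c))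
    (hf1 : ∀ c, f₁ c = -(q / (a₀ * q ^ ν)) * G ν (q * c) / G ν c)
    (hf2 : ∀ c, f₂ c = -1) :
    ∀ c : ℂ, G ν c ≠ 0 → G ν (q * c) ≠ 0 → G ν (q * (q * c)) ≠ 0 →
      1 + a₀ * q ^ ν * f₀ c + q * f₀ c * f₁ c ≠ 0 →
      1 + q ^ (1 - ν) / a₀ * f₁ c + q ^ (1 - ν) / a₀ * f₁ c * f₂ c ≠ 0 →
      1 + f₂ c + a₀ * q ^ ν * f₂ c * f₀ c ≠ 0 →
      f₀ (q * c) = q * f₁ c * (1 + f₂ c + a₀ * q ^ ν * f₂ c * f₀ c) /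
          (1 + a₀ * q ^ ν * f₀ c + q * f₀ c * f₁ c) ∧
      f₁ (q * c) = q ^ (1 - ν) / a₀ * f₂ c * (1 + a₀ * q ^ ν * f₀ c + q * f₀ c * f₁ c) /
          (1 + q ^ (1 - ν) / a₀ * f₁ c + q ^ (1 - ν) / a₀ * f₁ c * f₂ c) ∧
      f₂ (q * c) = a₀ * q ^ ν * f₀ c *
          (1 + q ^ (1 - ν) / a₀ * f₁ c + q ^ (1 - ν) / a₀ * f₁ c * f₂ c) /
          (1 + f₂ c + a₀ * q ^ ν * f₂ c * f₀ c) := by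
  intro c hg hg1 hg2 _ _ hD2
  have hQ : q ^ ν ≠ 0 := zpow_ne_zero ν hq
  have hratio : q ^ (1 - ν) / a₀ = q / (a₀ * q ^ ν) := by
    rw [zpow_sub₀ hq, zpow_one]
    field_simp
  have hrec : G ν (q * (q * c)) =
      G ν (q * c) * (1 - q ^ 2 * c ^ 2) + (a₀ * q ^ ν) ^ 2 * c ^ 2 * G ν c := by
    have h1 := hc1 ν c
    rw [mul_comm 2 ν, zpow_mul, zpow_ofNat] at h1
    linear_combination h1 - hc2 ν (q * c)
  have hprod : f₀ c * f₁ c = -(q * c ^ 2) := by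
    rw [hf0, hf1]
    generalize G ν (q * c) = y at hg1 ⊢
    field_simp
  have hden0 : 1 + a₀ * q ^ ν * f₀ c + q * f₀ c * f₁ c = G ν (q * (q * c)) / G ν (q * c) := by
    rw [mul_assoc q, hprod, hf0, hrec]
    generalize G ν (q * c) = y at hg1 ⊢
    field_simp
    ring
  have hden1 : 1 + q ^ (1 - ν) / a₀ * f₁ c + q ^ (1 - ν) / a₀ * f₁ c * f₂ c = 1 := by
    rw [hf2]
    ring
  have hden2 : 1 + f₂ c + a₀ * q ^ ν * f₂ c * f₀ c = -(a₀ * q ^ ν * f₀ c) := by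
    rw [hf2]
    ring
  rw [hden2] at hD2
  rw [hden0, hden1, hden2]
  refine ⟨?_, ?_, ?_⟩
  · have hnum : q * f₁ c * -(a₀ * q ^ ν * f₀ c) = q ^ 2 * c ^ 2 * (a₀ * q ^ ν) := by
      linear_combination -(q * a₀ * q ^ ν) * hprod
    rw [hnum, hf0]
    field_simp
  · rw [hratio, hf1, hf2]
    field_simp
  · rw [hf2, mul_one, div_neg, div_self (neg_ne_zero.mp hD2)]

end
end

section
/- Three-term relations from the contiguity relations: let q, a₀ ∈ ℂ∖{0} and let G : ℤ × ℂ → ℂ satisfy the contiguity relations. Then for all ν ∈ ℤ and c ∈ ℂ: (i) G_ν(q²c) = (1 - q²c²)G_ν(qc) + a₀²q^{2ν}c²G_ν(c), and (ii) G_{ν+2}(c) = (c² + 1)G_{ν+1}(c) - c²(1 - a₀²q^{2ν})G_ν(c). -/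
noncomputable section

/-- Three-term relations derived from the contiguity relations of `G_ν(c)`. -/
theorem qHermite_three_term (q a₀ : ℂ) (hq : q ≠ 0) (ha : a₀ ≠ 0)
    (G : ℤ → ℂ → ℂ)
    (hc1 : ∀ (μ : ℤ) (c : ℂ), G (μ + 1) (q * c) = G μ (q * c) + a₀ ^ 2 * q ^ (2 * μ) * c ^ 2 * G μ c)
    (hc2 : ∀ (μ : ℤ) (c : ℂ), G (μ + 1) c = G μ (q * c) + c ^ 2 * G μ c) :
    ∀ (ν : ℤ) (c : ℂ),
      G ν (q * (q * c)) = (1 - q ^ 2 * c ^ 2) * G ν (q * c) + a₀ ^ 2 * q ^ (2 * ν) * c ^ 2 * G ν c ∧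
      G (ν + 2) c = (c ^ 2 + 1) * G (ν + 1) c - c ^ 2 * (1 - a₀ ^ 2 * q ^ (2 * ν)) * G ν c := by
  intro ν c
  have h₂ := hc2 (ν + 1) c
  rw [add_assoc, one_add_one_eq_two] at h₂
  constructor
  · linear_combination hc1 ν c - hc2 ν (q * c)
  · linear_combination h₂ + hc1 ν c - hc2 ν c

end
end

section
/- Linearization of the discrete Riccati equation: let q, a₀ ∈ ℂ∖{0}, ν ∈ ℤ, and let G : ℂ → ℂ satisfy the linear q-difference equation G(q²c) = (1 - q²c²)G(qc) + a₀²q^{2ν}c²G(c) for all c ∈ ℂ. Then the function f₁(c) = -(q/(a₀q^ν)) G(qc)/G(c) satisfies, at every c with G(c) ≠ 0 and G(qc) ≠ 0, the discrete Riccati equation f₁(qc) · f₁(c) = -(q/(a₀q^ν))(1 - q²c²) f₁(c) + q²c². -/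
noncomputable section

/-- Linearization of the discrete Riccati equation: `f₁(c) = -(q/(a₀qᵛ)) G(qc)/G(c)`
satisfies the discrete Riccati equation whenever `G` satisfies the linear q-difference
equation `G(q²c) = (1 - q²c²)G(qc) + a₀²q^{2ν}c²G(c)`. -/
theorem discrete_Riccati_linearization (q a₀ : ℂ) (hq : q ≠ 0) (ha : a₀ ≠ 0) (ν : ℤ)
    (G : ℂ → ℂ)
    (hG : ∀ c : ℂ, G (q * (q * c)) = (1 - q ^ 2 * c ^ 2) * G (q * c) + a₀ ^ 2 * q ^ (2 * ν) * c ^ 2 * G c)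
    (f₁ : ℂ → ℂ)
    (hf₁ : ∀ c, f₁ c = -(q / (a₀ * q ^ ν)) * G (q * c) / G c) :
    ∀ c : ℂ, G c ≠ 0 → G (q * c) ≠ 0 →
      f₁ (q * c) * f₁ c = -(q / (a₀ * q ^ ν)) * (1 - q ^ 2 * c ^ 2) * f₁ c + q ^ 2 * c ^ 2 := by
  intro c hc hqc
  have hν : q ^ ν ≠ 0 := zpow_ne_zero ν hq
  rw [hf₁ (q * c), hf₁ c, hG c, mul_comm 2 ν, zpow_mul, zpow_ofNat]
  generalize q ^ ν = p at hν ⊢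
  field_simp

end
end

section
/- Toeplitz determinant solutions of qP_IV (Theorem): let q, a₀ ∈ ℂ∖{0}, ν ∈ ℤ, N ∈ ℕ, and let G : ℤ × ℂ → ℂ satisfy the contiguity relations. Define the Toeplitz determinants φ_M^μ(c) = det(G_{μ-i+j}(c))_{1≤i,j≤M} for M ≥ 1 and φ_0^μ(c) = 1. Define f₀(c) = a₀q^ν c² φ_{N+1}^ν(c)φ_N^ν(qc)/(φ_{N+1}^ν(qc)φ_N^ν(c)), f₁(c) = -(1/(a₀q^{ν+N-1})) φ_{N+1}^ν(qc)φ_N^{ν-1}(c)/(φ_{N+1}^ν(c)φ_N^{ν-1}(qc)), f₂(c) = -q^N φ_N^{ν-1}(qc)φ_N^ν(c)/(φ_N^ν(qc)φ_N^{ν-1}(c)). Then, at every c at which all the determinants φ appearing above (at arguments c, qc, q²c) are nonzero and all denominators below are nonzero, (f₀,f₁,f₂) satisfies the qP_IV system with a₂ = 1: f₀(qc) = q^{N+1} f₁(c)(1 + q^{-N}f₂(c) + a₀q^{ν-N}f₂(c)f₀(c))/(1 + a₀q^ν f₀(c) + q^{N+1}f₀(c)f₁(c)), f₁(qc) = (q^{1-ν}/a₀)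 f₂(c)(1 + a₀q^ν f₀(c) + q^{N+1}f₀(c)f₁(c))/(1 + (q^{N-ν+1}/a₀)f₁(c) + (q^{1-ν}/a₀)f₁(c)f₂(c)), f₂(qc) = a₀q^{ν-N} f₀(c)(1 + (q^{N-ν+1}/a₀)f₁(c) + (q^{1-ν}/a₀)f₁(c)f₂(c))/(1 + q^{-N}f₂(c) + a₀q^{ν-N}f₂(c)f₀(c)). -/
noncomputable section

/-- The `M × M` Toeplitz determinant `φ_M^μ(c) = det(G_{μ-i+j}(c))_{1≤i,j≤M}`
(with `φ_0^μ(c) = 1`). -/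
def phiT (G : ℤ → ℂ → ℂ) (M : ℕ) (μ : ℤ) (c : ℂ) : ℂ :=
  Matrix.det (Matrix.of fun i j : Fin M => G (μ - ((i : ℕ) : ℤ) + ((j : ℕ) : ℤ)) c)

/-- The determinant of the first `n` entries of `n` sequences. -/
def rowDet {R : Type*} [CommRing R] {n : ℕ} (ρ : Fin n → ℕ → R) : R :=
  Matrix.det (Matrix.of fun i j : Fin n => ρ i j)

/-- The operator `E - w`, where `E` is the shift of sequences. -/
def shiftSub {R : Type*} [CommRing R] (w : R) (s : ℕ → R) : ℕ → R :=
  fun j => s (j + 1) - w * s j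

/-- The operator `E - w`, where `E` is the shift of two-sided sequences. -/
def intShiftSub {R : Type*} [CommRing R] (w : R) (g : ℤ → R) : ℤ → R :=
  fun k => g (k + 1) - w * g k

/-- The rows of the Toeplitz matrix with symbol sequence `g`. -/
def toeplitzRows {R : Type*} (g : ℤ → R) (μ : ℤ) (n : ℕ) : Fin n → ℕ → R :=
  fun i j => g (μ - ((i : ℕ) : ℤ) + (j : ℤ))

/-- The Toeplitz determinant of the sequence `g`. -/
def toeplitzDet {R : Type*} [CommRing R] (g : ℤ → R) (n : ℕ) (μ : ℤ) : R :=
  rowDet (toeplitzRows g μ n)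

/-- The three-term Plücker relation for two rows of a square matrix. -/
theorem det_mul_det_updateRow_updateRow {R ι : Type*} [CommRing R] [Fintype ι] [DecidableEq ι]
    (M : Matrix ι ι R) {p q : ι} (hpq : p ≠ q) (c d : ι → R) :
    M.det * ((M.updateRow p c).updateRow q d).det =
      (M.updateRow p c).det * (M.updateRow q d).det -
        (M.updateRow q c).det * (M.updateRow p d).det := by
  have hc : M.det • c = ∑ k, (M.updateRow k c).det • M.row k := by
    have h := Matrix.mulVec_cramer M.transpose c
    rw [Matrix.det_transpose] at h
    rw [← h]
    ext j
    simp only [Matrix.mulVec, dotProduct, Matrix.transpose_apply, Finset.sum_apply, Pi.smul_apply,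
      smul_eq_mul, Matrix.cramer_transpose_apply, Matrix.row]
    exact Finset.sum_congr rfl fun k _ => mul_comm _ _
  have hlin : M.det * ((M.updateRow p c).updateRow q d).det =
      ∑ k, (M.updateRow k c).det * ((M.updateRow q d).updateRow p (M.row k)).det := by
    rw [Matrix.updateRow_comm _ hpq, ← Matrix.det_updateRow_smul, hc]
    exact (map_sum ((Matrix.detRowAlternating (R := R) (n := ι)).toMultilinearMap.toLinearMap
      (M.updateRow q d) p) _ _).trans (Finset.sum_congr rfl fun k _ => by
        rw [map_smul]; rfl)
  rw [hlin, ← Finset.add_sum_erase _ _ (Finset.mem_univ p),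
    ← Finset.add_sum_erase _ _ (Finset.mem_erase.2 ⟨hpq.symm, Finset.mem_univ q⟩),
    Finset.sum_eq_zero, add_zero]
  · have hp : (M.updateRow q d).updateRow p (M.row p) = M.updateRow q d := by
      ext i j
      by_cases hi : i = p
      · subst hi; simp [hpq]
      · simp [hi]
    have hq : ((M.updateRow q d).updateRow p (M.row q)).det = -(M.updateRow p d).det := by
      have h := Matrix.det_permute (Equiv.swap p q) (M.updateRow p d)
      rw [Equiv.Perm.sign_swap hpq] at h
      have hM : (M.updateRow q d).updateRow p (M.row q) =
          (M.updateRow p d).submatrix (Equiv.swap p q) id := by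
        ext i j
        by_cases hi : i = p
        · subst hi; simp [hpq.symm]
        · by_cases hi' : i = q
          · subst hi'; simp [hi]
          · simp [Equiv.swap_apply_of_ne_of_ne hi hi', hi, hi']
      rw [hM, h]
      simp
    rw [hp, hq]
    ring
  · intro k hk
    simp only [Finset.mem_erase, Finset.mem_univ, and_true] at hk
    refine mul_eq_zero_of_right _ (Matrix.det_zero_of_row_eq (i := p) (j := k) (Ne.symm hk.2) ?_)
    ext j
    simp [hk.1, hk.2]

theorem rowDet_cons_snoc_mul {R : Type*} [CommRing R] {n : ℕ} (ρ : Fin n → ℕ → R)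
    (a b c d : ℕ → R) :
    rowDet (Fin.cons a (Fin.snoc ρ b : Fin (n + 1) → ℕ → R) : Fin (n + 2) → ℕ → R) *
        rowDet (Fin.cons c (Fin.snoc ρ d : Fin (n + 1) → ℕ → R) : Fin (n + 2) → ℕ → R) =
      rowDet (Fin.cons c (Fin.snoc ρ b : Fin (n + 1) → ℕ → R) : Fin (n + 2) → ℕ → R) *
          rowDet (Fin.cons a (Fin.snoc ρ d : Fin (n + 1) → ℕ → R) : Fin (n + 2) → ℕ → R) -
        rowDet (Fin.cons a (Fin.snoc ρ c : Fin (n + 1) → ℕ → R) : Fin (n + 2) → ℕ → R) *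
          rowDet (Fin.cons d (Fin.snoc ρ b : Fin (n + 1) → ℕ → R) : Fin (n + 2) → ℕ → R) := by
  have h0 : (0 : Fin (n + 2)) ≠ Fin.last (n + 1) := (Fin.last_pos).ne
  have hl (x y z : ℕ → R) :
      (Matrix.of fun i j : Fin (n + 2) =>
        (Fin.cons x (Fin.snoc ρ y : Fin (n + 1) → ℕ → R) : Fin (n + 2) → ℕ → R) i j).updateRow
          (Fin.last (n + 1)) (fun j => z j) = Matrix.of fun i j : Fin (n + 2) =>
        (Fin.cons x (Fin.snoc ρ z : Fin (n + 1) → ℕ → R) : Fin (n + 2) → ℕ → R) i j := by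
    ext i j
    refine Fin.cases ?_ (fun i => Fin.lastCases ?_ (fun i => ?_) i) i
    · simp [Matrix.updateRow_apply, h0]
    · simp [Matrix.updateRow_apply]
    · simp [Matrix.updateRow_apply, ← Fin.succ_last,
        (Fin.castSucc_lt_last i).ne]
  have hf (x y z : ℕ → R) :
      (Matrix.of fun i j : Fin (n + 2) =>
        (Fin.cons x (Fin.snoc ρ y : Fin (n + 1) → ℕ → R) : Fin (n + 2) → ℕ → R) i j).updateRow
          0 (fun j => z j) = Matrix.of fun i j : Fin (n + 2) =>
        (Fin.cons z (Fin.snoc ρ y : Fin (n + 1) → ℕ → R) : Fin (n + 2) → ℕ → R) i j := by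
    ext i j
    refine Fin.cases ?_ (fun i => ?_) i
    · simp [Matrix.updateRow_apply]
    · simp [Matrix.updateRow_apply, Fin.succ_ne_zero]
  have h := det_mul_det_updateRow_updateRow (Matrix.of fun i j : Fin (n + 2) =>
    (Fin.cons a (Fin.snoc ρ b : Fin (n + 1) → ℕ → R) : Fin (n + 2) → ℕ → R) i j) h0
    (fun j => c j) (fun j => d j)
  rwa [hf, hl, hl, hl, hf] at h

/-- A row of powers of `w` can be removed by applying `E - w` to the other rows. -/
theorem rowDet_of_geometric_row {R : Type*} [CommRing R] {n : ℕ} (ρ : Fin (n + 1) → ℕ → R)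
    (p : Fin (n + 1)) (w : R) (hp : ρ p = fun j => w ^ j) :
    rowDet ρ = (-1) ^ (p : ℕ) * rowDet (fun i => shiftSub w (ρ (p.succAbove i))) := by
  have h : rowDet ρ = Matrix.det (Matrix.of fun i j : Fin (n + 1) =>
      (Fin.cons (ρ i 0) (fun j : Fin n => shiftSub w (ρ i) j) : Fin (n + 1) → R) j) := by
    refine Matrix.det_eq_of_forall_col_eq_smul_add_pred (fun _ => w) (fun i => ?_) fun i j => ?_
    · simp
    · simp [shiftSub]
  rw [h, Matrix.det_succ_row _ p, Finset.sum_eq_single 0]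
  · simp only [Fin.val_zero, add_zero, Matrix.of_apply, Fin.cons_zero, hp, pow_zero, mul_one]
    congr 1
  · intro j _ hj
    obtain ⟨j, rfl⟩ := Fin.exists_succ_eq.2 hj
    simp [shiftSub, hp, pow_succ']
  · simp

theorem rowDet_cons_pow {R : Type*} [CommRing R] {n : ℕ} (ρ : Fin n → ℕ → R) (w : R) :
    rowDet (Fin.cons (fun j => w ^ j) ρ : Fin (n + 1) → ℕ → R) = rowDet (shiftSub w ∘ ρ) := by
  rw [rowDet_of_geometric_row _ 0 w (Fin.cons_zero ..)]
  simp [Function.comp_def]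

theorem rowDet_snoc_pow {R : Type*} [CommRing R] {n : ℕ} (ρ : Fin n → ℕ → R) (w : R) :
    rowDet (Fin.snoc ρ (fun j => w ^ j) : Fin (n + 1) → ℕ → R) =
      (-1) ^ n * rowDet (shiftSub w ∘ ρ) := by
  rw [rowDet_of_geometric_row _ (Fin.last n) w (Fin.snoc_last ..)]
  simp [Function.comp_def]

theorem rowDet_snoc_smul {R : Type*} [CommRing R] {n : ℕ} (ρ : Fin n → ℕ → R) (k : R)
    (s : ℕ → R) :
    rowDet (Fin.snoc ρ (k • s) : Fin (n + 1) → ℕ → R) =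
      k * rowDet (Fin.snoc ρ s : Fin (n + 1) → ℕ → R) := by
  simp only [rowDet]
  rw [Matrix.det_succ_row _ (Fin.last n), Matrix.det_succ_row _ (Fin.last n), Finset.mul_sum]
  refine Finset.sum_congr rfl fun j _ => ?_
  simp only [Matrix.of_apply, Fin.snoc_last, Pi.smul_apply, smul_eq_mul]
  have : ∀ s : ℕ → R, (Matrix.of fun i j : Fin (n + 1) =>
      (Fin.snoc ρ s : Fin (n + 1) → ℕ → R) i j).submatrix (Fin.last n).succAbove j.succAbove =
      Matrix.of fun i j' => ρ i (j.succAbove j') := by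
    intro s; ext; simp
  rw [this, this]
  ring

theorem rowDet_cons_single_zero {R : Type*} [CommRing R] {n : ℕ} (ρ : Fin n → ℕ → R) :
    rowDet (Fin.cons (Pi.single 0 1) ρ : Fin (n + 1) → ℕ → R) =
      rowDet (fun i j => ρ i (j + 1)) := by
  rw [rowDet, Matrix.det_succ_row_zero, Finset.sum_eq_single 0]
  · simp [rowDet, Matrix.submatrix]
  · intro j _ hj
    simp [hj]
  · simp

theorem rowDet_cons_single_last {R : Type*} [CommRing R] {n : ℕ} (ρ : Fin n → ℕ → R) :
    rowDet (Fin.cons (Pi.single n 1) ρ : Fin (n + 1) → ℕ → R) = (-1) ^ n * rowDet ρ := by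
  rw [rowDet, Matrix.det_succ_row_zero, Finset.sum_eq_single (Fin.last n)]
  · simp [rowDet, Matrix.submatrix]
  · intro j _ hj
    simp [show (j : ℕ) ≠ n from fun h => hj (Fin.ext h)]
  · simp

theorem rowDet_snoc_single_last {R : Type*} [CommRing R] {n : ℕ} (ρ : Fin n → ℕ → R) :
    rowDet (Fin.snoc ρ (Pi.single n 1) : Fin (n + 1) → ℕ → R) = rowDet ρ := by
  rw [rowDet, Matrix.det_succ_row _ (Fin.last n), Finset.sum_eq_single (Fin.last n)]
  · simp [rowDet, Matrix.submatrix, ← two_mul]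
  · intro j _ hj
    simp [show (j : ℕ) ≠ n from fun h => hj (Fin.ext h)]
  · simp

theorem toeplitzRows_succ_eq_snoc {R : Type*} (g : ℤ → R) (μ : ℤ) (n : ℕ) :
    toeplitzRows g μ (n + 1) =
      (Fin.snoc (toeplitzRows g μ n) (fun j => g (μ - n + j)) : Fin (n + 1) → ℕ → R) := by
  ext i j
  refine Fin.lastCases ?_ (fun i => ?_) i <;> simp [toeplitzRows]

theorem toeplitzRows_succ_eq_cons {R : Type*} (g : ℤ → R) (μ : ℤ) (n : ℕ) :
    toeplitzRows g μ (n + 1) =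
      (Fin.cons (fun j => g (μ + j)) (toeplitzRows g (μ - 1) n) : Fin (n + 1) → ℕ → R) := by
  ext i j
  refine Fin.cases ?_ (fun i => ?_) i
  · simp [toeplitzRows]
  · simp only [toeplitzRows, Fin.val_succ, Fin.cons_succ]
    congr 1
    push_cast
    ring

theorem shiftSub_comp_toeplitzRows {R : Type*} [CommRing R] (g : ℤ → R) (w : R) (μ : ℤ) (n : ℕ) :
    shiftSub w ∘ toeplitzRows g μ n = toeplitzRows (intShiftSub w g) μ n := by
  ext i j
  simp [toeplitzRows, shiftSub, intShiftSub, add_assoc]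

theorem shiftSub_pow {R : Type*} [CommRing R] (w t : R) :
    shiftSub w (fun j => t ^ j) = (t - w) • (fun j => t ^ j : ℕ → R) := by
  ext j
  simp only [shiftSub, Pi.smul_apply, smul_eq_mul]
  ring

theorem rowDet_cons_pow_snoc_pow {R : Type*} [CommRing R] (g : ℤ → R) (w t : R) (μ : ℤ)
    (n : ℕ) :
    rowDet (Fin.cons (fun j => w ^ j) (Fin.snoc (toeplitzRows g μ n) (fun j => t ^ j) :
        Fin (n + 1) → ℕ → R) : Fin (n + 2) → ℕ → R) =
      (t - w) * ((-1) ^ n * toeplitzDet (intShiftSub t (intShiftSub w g)) n μ) := by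
  rw [rowDet_cons_pow, Fin.comp_snoc, shiftSub_pow, rowDet_snoc_smul, rowDet_snoc_pow,
    shiftSub_comp_toeplitzRows, shiftSub_comp_toeplitzRows, toeplitzDet]

theorem toeplitzDet_bilinear_size {R : Type*} [CommRing R] (g : ℤ → R) (w t : R) (ν : ℤ)
    (N : ℕ) :
    (w - t) * toeplitzDet g (N + 1) ν * toeplitzDet (intShiftSub t (intShiftSub w g)) N ν =
      toeplitzDet (intShiftSub w g) N ν * toeplitzDet (intShiftSub t g) (N + 1) ν -
        toeplitzDet (intShiftSub w g) (N + 1) ν * toeplitzDet (intShiftSub t g) N ν := by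
  have h := rowDet_cons_snoc_mul (toeplitzRows g ν N) (Pi.single (N + 1) 1)
    (fun j => g (ν - N + j)) (fun j => w ^ j) (fun j => t ^ j)
  rw [rowDet_cons_pow_snoc_pow] at h
  simp only [← toeplitzRows_succ_eq_snoc, rowDet_cons_single_last, rowDet_cons_pow,
    rowDet_snoc_pow, shiftSub_comp_toeplitzRows] at h
  have hs : ((-1 : R) ^ N) * (-1) ^ N = 1 := by rw [← mul_pow]; simp
  simp only [toeplitzDet] at h ⊢
  linear_combination h -
    ((w - t) * rowDet (toeplitzRows g ν (N + 1)) *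
        rowDet (toeplitzRows (intShiftSub t (intShiftSub w g)) ν N) -
      rowDet (toeplitzRows (intShiftSub w g) ν N) *
        rowDet (toeplitzRows (intShiftSub t g) ν (N + 1)) +
      rowDet (toeplitzRows (intShiftSub w g) ν (N + 1)) *
        rowDet (toeplitzRows (intShiftSub t g) ν N)) * hs

theorem toeplitzDet_bilinear_index {R : Type*} [CommRing R] (g : ℤ → R) (w t : R) (ν : ℤ)
    (N : ℕ) :
    (w - t) * toeplitzDet g N ν *
        toeplitzDet (intShiftSub t (intShiftSub w g)) N (ν - 1) =
      w * toeplitzDet (intShiftSub w g) N ν * toeplitzDet (intShiftSub t g) N (ν - 1) -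
        t * toeplitzDet (intShiftSub w g) N (ν - 1) * toeplitzDet (intShiftSub t g) N ν := by
  have hshift : (fun (i : Fin N) (j : ℕ) => toeplitzRows g (ν - 1) N i (j + 1)) =
      toeplitzRows g ν N := by
    ext i j
    simp only [toeplitzRows]
    congr 1
    push_cast
    ring
  have hpow (x : R) : rowDet (Fin.cons (Pi.single 0 1) (Fin.snoc (toeplitzRows g (ν - 1) N)
      (fun j => x ^ j) : Fin (N + 1) → ℕ → R) : Fin (N + 2) → ℕ → R) =
      x * ((-1) ^ N * toeplitzDet (intShiftSub x g) N ν) := by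
    have : (fun (i : Fin (N + 1)) (j : ℕ) => (Fin.snoc (toeplitzRows g (ν - 1) N)
        (fun j => x ^ j) : Fin (N + 1) → ℕ → R) i (j + 1)) =
        (Fin.snoc (toeplitzRows g ν N) (x • fun j => x ^ j) : Fin (N + 1) → ℕ → R) := by
      rw [← hshift]
      ext i j
      refine Fin.lastCases ?_ (fun i => ?_) i
      · simp [pow_succ']
      · simp
    rw [rowDet_cons_single_zero, this, rowDet_snoc_smul, rowDet_snoc_pow,
      shiftSub_comp_toeplitzRows, toeplitzDet]
  have hlast (x : R) : rowDet (Fin.cons (fun j => x ^ j) (Fin.snoc (toeplitzRows g (ν - 1) N)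
      (Pi.single (N + 1) 1) : Fin (N + 1) → ℕ → R) : Fin (N + 2) → ℕ → R) =
      toeplitzDet (intShiftSub x g) N (ν - 1) := by
    rw [Fin.cons_snoc_eq_snoc_cons, rowDet_snoc_single_last, rowDet_cons_pow,
      shiftSub_comp_toeplitzRows, toeplitzDet]
  have hends : rowDet (Fin.cons (Pi.single 0 1) (Fin.snoc (toeplitzRows g (ν - 1) N)
      (Pi.single (N + 1) 1) : Fin (N + 1) → ℕ → R) : Fin (N + 2) → ℕ → R) =
      toeplitzDet g N ν := by
    rw [Fin.cons_snoc_eq_snoc_cons, rowDet_snoc_single_last, rowDet_cons_single_zero, hshift,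
      toeplitzDet]
  have h := rowDet_cons_snoc_mul (toeplitzRows g (ν - 1) N) (Pi.single 0 1)
    (Pi.single (N + 1) 1) (fun j => w ^ j) (fun j => t ^ j)
  rw [rowDet_cons_pow_snoc_pow, hpow, hpow, hlast, hlast, hends] at h
  have hs : ((-1 : R) ^ N) * (-1) ^ N = 1 := by rw [← mul_pow]; simp
  linear_combination -(-1) ^ N * h -
    ((w - t) * toeplitzDet g N ν *
        toeplitzDet (intShiftSub t (intShiftSub w g)) N (ν - 1) -
      w * toeplitzDet (intShiftSub w g) N ν * toeplitzDet (intShiftSub t g) N (ν - 1) +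
      t * toeplitzDet (intShiftSub w g) N (ν - 1) * toeplitzDet (intShiftSub t g) N ν) * hs

theorem rowDet_cons_toeplitzRows {R : Type*} [CommRing R] (g : ℤ → R) (ν : ℤ) (n : ℕ)
    (s : ℕ → R) :
    rowDet (Fin.cons s (Fin.snoc (toeplitzRows g (ν - 1) n) (fun j => g (ν - 1 - n + j)) :
        Fin (n + 1) → ℕ → R) : Fin (n + 2) → ℕ → R) =
      rowDet (Fin.cons s (toeplitzRows g (ν - 1) (n + 1)) : Fin (n + 2) → ℕ → R) := by
  rw [toeplitzRows_succ_eq_snoc]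

theorem rowDet_snoc_toeplitzRows {R : Type*} [CommRing R] (g : ℤ → R) (ν : ℤ) (n : ℕ)
    (s : ℕ → R) :
    rowDet (Fin.cons (fun j => g (ν + j)) (Fin.snoc (toeplitzRows g (ν - 1) n) s :
        Fin (n + 1) → ℕ → R) : Fin (n + 2) → ℕ → R) =
      rowDet (Fin.snoc (toeplitzRows g ν (n + 1)) s : Fin (n + 2) → ℕ → R) := by
  rw [Fin.cons_snoc_eq_snoc_cons, ← toeplitzRows_succ_eq_cons]

theorem toeplitzDet_bilinear_corner {R : Type*} [CommRing R] (g : ℤ → R) (w t : R) (ν : ℤ)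
    (n : ℕ) :
    (w - t) * toeplitzDet g (n + 2) ν *
        toeplitzDet (intShiftSub t (intShiftSub w g)) n (ν - 1) =
      toeplitzDet (intShiftSub w g) (n + 1) (ν - 1) * toeplitzDet (intShiftSub t g) (n + 1) ν -
        toeplitzDet (intShiftSub w g) (n + 1) ν *
          toeplitzDet (intShiftSub t g) (n + 1) (ν - 1) := by
  have h := rowDet_cons_snoc_mul (toeplitzRows g (ν - 1) n) (fun j => g (ν + j))
    (fun j => g (ν - 1 - n + j)) (fun j => w ^ j) (fun j => t ^ j)
  rw [rowDet_cons_pow_snoc_pow, rowDet_cons_toeplitzRows, rowDet_cons_toeplitzRows,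
    rowDet_cons_toeplitzRows, rowDet_snoc_toeplitzRows, rowDet_snoc_toeplitzRows,
    ← toeplitzRows_succ_eq_cons] at h
  simp only [rowDet_cons_pow, rowDet_snoc_pow, shiftSub_comp_toeplitzRows] at h
  have hs : ((-1 : R) ^ n) * (-1) ^ n = 1 := by rw [← mul_pow]; simp
  simp only [toeplitzDet] at h ⊢
  linear_combination -(-1) ^ n * h -
    ((w - t) * rowDet (toeplitzRows g ν (n + 2)) *
        rowDet (toeplitzRows (intShiftSub t (intShiftSub w g)) (ν - 1) n) -
      rowDet (toeplitzRows (intShiftSub w g) (ν - 1) (n + 1)) *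
        rowDet (toeplitzRows (intShiftSub t g) ν (n + 1)) +
      rowDet (toeplitzRows (intShiftSub w g) ν (n + 1)) *
        rowDet (toeplitzRows (intShiftSub t g) (ν - 1) (n + 1))) * hs

theorem toeplitzDet_bilinear_shift {R : Type*} [CommRing R] (g : ℤ → R) (w : R) (ν : ℤ)
    (n : ℕ) :
    toeplitzDet g (n + 2) ν * toeplitzDet (intShiftSub w g) n (ν - 1) =
      toeplitzDet g (n + 1) ν * toeplitzDet (intShiftSub w g) (n + 1) (ν - 1) -
        toeplitzDet (intShiftSub w g) (n + 1) ν * toeplitzDet g (n + 1) (ν - 1) := by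
  have h := rowDet_cons_snoc_mul (toeplitzRows g (ν - 1) n) (fun j => g (ν + j))
    (fun j => g (ν - 1 - n + j)) (Pi.single (n + 1) 1) (fun j => w ^ j)
  rw [rowDet_cons_toeplitzRows, rowDet_cons_toeplitzRows,
    rowDet_cons_toeplitzRows, rowDet_snoc_toeplitzRows, rowDet_snoc_toeplitzRows,
    ← toeplitzRows_succ_eq_cons] at h
  simp only [rowDet_cons_pow, rowDet_snoc_pow, rowDet_cons_single_last, rowDet_snoc_single_last,
    shiftSub_comp_toeplitzRows] at h
  have hs : ((-1 : R) ^ n) * (-1) ^ n = 1 := by rw [← mul_pow]; simp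
  simp only [toeplitzDet] at h ⊢
  linear_combination -h -
    (rowDet (toeplitzRows g ν (n + 2)) * rowDet (toeplitzRows (intShiftSub w g) (ν - 1) n) +
      rowDet (toeplitzRows (intShiftSub w g) ν (n + 1)) *
        rowDet (toeplitzRows g (ν - 1) (n + 1))) * hs

theorem toeplitzDet_mul_zpow {K : Type*} [Field K] (g : ℤ → K) (x : K) {y : K} (hy : y ≠ 0)
    (n : ℕ) (μ : ℤ) :
    toeplitzDet (fun k => x * y ^ k * g k) n μ = (x * y ^ μ) ^ n * toeplitzDet g n μ := by
  have h : (Matrix.of fun i j : Fin n => toeplitzRows (fun k => x * y ^ k * g k) μ n i j) =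
      Matrix.of fun i j : Fin n => (x * y ^ μ * (y ^ (i : ℕ))⁻¹) *
        (Matrix.of fun i j : Fin n => y ^ (j : ℕ) *
          (Matrix.of fun i j : Fin n => toeplitzRows g μ n i j) i j) i j := by
    ext i j
    simp only [toeplitzRows, Matrix.of_apply, zpow_add₀ hy, zpow_sub₀ hy, zpow_natCast]
    ring
  rw [toeplitzDet, rowDet, h, Matrix.det_mul_column, Matrix.det_mul_row, toeplitzDet, rowDet,
    ← mul_assoc, ← Finset.prod_mul_distrib]
  congr 1
  simp [hy]

/-- The bilinear relations between the determinants `φ` at `c`, `qc` and `q²c`. -/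
theorem phiT_bilinear {q a₀ c : ℂ} (hq : q ≠ 0) (ha : a₀ ≠ 0) (hc : c ≠ 0) (ν : ℤ) (N : ℕ)
    (G : ℤ → ℂ → ℂ)
    (hc1 : ∀ (μ : ℤ) (c : ℂ), G (μ + 1) (q * c) = G μ (q * c) + a₀ ^ 2 * q ^ (2 * μ) * c ^ 2 * G μ c)
    (hc2 : ∀ (μ : ℤ) (c : ℂ), G (μ + 1) c = G μ (q * c) + c ^ 2 * G μ c) :
    ((1 - (q * c) ^ 2) * (q ^ N) ^ 2 * (phiT G (N + 1) ν (q * c) * phiT G N ν (q * c)) =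
      phiT G N ν c * phiT G (N + 1) ν (q * (q * c)) -
        a₀ ^ 2 * (q ^ ν) ^ 2 * c ^ 2 * (phiT G (N + 1) ν c * phiT G N ν (q * (q * c)))) ∧
    ((1 - (q * c) ^ 2) * (q ^ N) ^ 2 * (phiT G N ν (q * c) * phiT G N (ν - 1) (q * c)) =
      (q ^ N) ^ 2 * (phiT G N ν c * phiT G N (ν - 1) (q * (q * c))) -
        (q * c) ^ 2 * (phiT G N (ν - 1) c * phiT G N ν (q * (q * c)))) ∧
    ∃ V : ℂ,
      ((1 - (q * c) ^ 2) * (q ^ N) ^ 2 * (phiT G (N + 1) ν (q * c) * V) =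
        a₀ ^ 2 * (q ^ ν) ^ 2 * c ^ 2 * (phiT G N (ν - 1) c * phiT G N ν (q * (q * c)) -
          (q ^ N) ^ 2 * (phiT G N ν c * phiT G N (ν - 1) (q * (q * c))))) ∧
      (phiT G (N + 1) ν c * V =
        phiT G N ν c * phiT G N (ν - 1) (q * c) - phiT G N ν (q * c) * phiT G N (ν - 1) c) := by
  have hphi (M : ℕ) (μ : ℤ) (x : ℂ) : toeplitzDet (fun k => G k x) M μ = phiT G M μ x := rfl
  have hq2 : q ^ 2 ≠ 0 := pow_ne_zero 2 hq
  have hzpow (k : ℤ) : (q ^ 2) ^ k = q ^ (2 * k) := by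
    rw [zpow_mul]; norm_cast
  have hzpow' : (q ^ 2) ^ ν = (q ^ ν) ^ 2 := by
    rw [← zpow_natCast, ← zpow_natCast, ← zpow_mul, ← zpow_mul, mul_comm]
  have hrow (x : ℂ) : intShiftSub (x ^ 2) (fun k => G k x) = fun k => G k (q * x) := by
    ext k
    simp only [intShiftSub, hc2 k x]
    ring
  have hone : intShiftSub 1 (fun k => G k (q * c)) =
      fun k => a₀ ^ 2 * c ^ 2 * (q ^ 2) ^ k * G k c := by
    ext k
    simp only [intShiftSub, hc1 k c, hzpow]
    ring
  have hboth : intShiftSub ((q * c) ^ 2) (intShiftSub 1 (fun k => G k (q * c))) =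
      fun k => a₀ ^ 2 * c ^ 2 * q ^ 2 * (q ^ 2) ^ k * G k (q * c) := by
    rw [hone]
    ext k
    simp only [intShiftSub, hc2 k c, zpow_add_one₀ hq2]
    ring
  have hpred : (q ^ 2) ^ (ν - 1) = (q ^ ν) ^ 2 / q ^ 2 := by
    rw [zpow_sub_one₀ hq2, hzpow']; rfl
  have hK : a₀ ^ 2 * (q ^ ν) ^ 2 * c ^ 2 ≠ 0 := by
    have := zpow_ne_zero ν hq
    positivity
  have h4 := toeplitzDet_bilinear_size (fun k => G k (q * c)) 1 ((q * c) ^ 2) ν N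
  have h3 := toeplitzDet_bilinear_index (fun k => G k (q * c)) 1 ((q * c) ^ 2) ν N
  rw [hboth, hone, hrow] at h4 h3
  simp only [toeplitzDet_mul_zpow _ _ hq2, hphi, hpred, hzpow'] at h4 h3
  have e1 : a₀ ^ 2 * c ^ 2 * q ^ 2 * (q ^ ν) ^ 2 =
    (a₀ ^ 2 * (q ^ ν) ^ 2 * c ^ 2) * q ^ 2 := by ring
  have e2 : a₀ ^ 2 * c ^ 2 * (q ^ ν) ^ 2 = a₀ ^ 2 * (q ^ ν) ^ 2 * c ^ 2 := by ring
  have e3 : a₀ ^ 2 * c ^ 2 * q ^ 2 * ((q ^ ν) ^ 2 / q ^ 2) = a₀ ^ 2 * (q ^ ν) ^ 2 * c ^ 2 := by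
    field_simp
  have e4 : a₀ ^ 2 * c ^ 2 * ((q ^ ν) ^ 2 / q ^ 2) =
    (a₀ ^ 2 * (q ^ ν) ^ 2 * c ^ 2) / q ^ 2 := by field_simp
  have e5 : (q ^ 2) ^ N = (q ^ N) ^ 2 := by rw [← pow_mul, ← pow_mul, mul_comm]
  have hm : q ^ N ≠ 0 := pow_ne_zero N hq
  rw [e1, e2, mul_pow _ (q ^ 2), e5] at h4
  rw [e2, e3, e4, div_pow, e5] at h3
  generalize a₀ ^ 2 * (q ^ ν) ^ 2 * c ^ 2 = K at *
  have hKN : K ^ N ≠ 0 := pow_ne_zero N hK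
  refine ⟨?_, ?_, ?_⟩
  · apply mul_left_cancel₀ hKN
    rw [pow_succ] at h4
    linear_combination h4
  · apply mul_left_cancel₀ hKN
    have hinv := div_mul_cancel₀ (K ^ N) (pow_ne_zero 2 hm)
    generalize K ^ N / (q ^ N) ^ 2 = L at *
    linear_combination (q ^ N) ^ 2 * h3 -
      (q * c) ^ 2 * (phiT G N (ν - 1) c * phiT G N ν (q * (q * c))) * hinv
  · obtain _ | n := N
    · refine ⟨0, ?_, ?_⟩ <;> simp [phiT]
    · have h5 := toeplitzDet_bilinear_corner (fun k => G k (q * c)) 1 ((q * c) ^ 2) ν n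
      have h1 := toeplitzDet_bilinear_shift (fun k => G k c) (c ^ 2) ν n
      rw [hboth, hone, hrow] at h5
      rw [hrow] at h1
      simp only [toeplitzDet_mul_zpow _ _ hq2, hphi, hpred, hzpow'] at h5 h1
      rw [e2, e3, e4, div_pow, e5] at h5
      refine ⟨phiT G n (ν - 1) (q * c), ?_, h1⟩
      apply mul_left_cancel₀ (pow_ne_zero n hK)
      have hinv := div_mul_cancel₀ (K ^ (n + 1)) (pow_ne_zero 2 hm)
      generalize K ^ (n + 1) / (q ^ (n + 1)) ^ 2 = L at *
      linear_combination (q ^ (n + 1)) ^ 2 * h5 +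
        phiT G (n + 1) (ν - 1) c * phiT G (n + 1) ν (q * (q * c)) * hinv

/-- The step from the bilinear relations to the equations of qP_IV, cleared of denominators. -/
theorem bilinear_elimination {R : Type*} [Field R] {A A₁ A₂ B B₁ B₂ F F₁ F₂ V K t m : R}
    (hm : m ≠ 0)
    (hsize : (1 - t) * m ^ 2 * (F₁ * A₁) = A * F₂ - K * (F * A₂))
    (hindex : (1 - t) * m ^ 2 * (A₁ * B₁) = m ^ 2 * (A * B₂) - t * (B * A₂))
    (hcorner : (1 - t) * m ^ 2 * (F₁ * V) = K * (B * A₂ - m ^ 2 * (A * B₂)))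
    (hshift : F * V = A * B₁ - A₁ * B) :
    K * A₂ * F * (F₁ * (A * B₁ - t * A₁ * B) + K * F * A₁ * B₁) +
        F₂ * A * (F₁ * (A₁ * B - A * B₁) - K * F * A₁ * B₁) = 0 ∧
      m ^ 2 * A * B₂ * (F₁ * (A₁ * B - A * B₁) - K * F * A₁ * B₁) +
        A₂ * B * (K * A₁ * B₁ * F - t * F₁ * (A₁ * B - A * B₁)) = 0 := by
  refine ⟨?_, ?_⟩
  · apply mul_left_cancel₀ (pow_ne_zero 2 hm)
    linear_combination
      -(m ^ 2 * (F₁ * (A₁ * B - A * B₁) - K * F * A₁ * B₁)) * hsize +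
        m ^ 2 * F₁ * A₁ * (-F * hcorner - K * F * hindex + (1 - t) * m ^ 2 * F₁ * hshift)
  · linear_combination -F₁ * (A₁ * B - A * B₁) * hindex +
      F₁ * (1 - t) * m ^ 2 * A₁ * B₁ * hshift - F * A₁ * B₁ * hcorner

/-- Toeplitz determinant solutions of qP_IV (with `a₂ = 1`). -/
theorem qPIV_Toeplitz_solution (q a₀ : ℂ) (hq : q ≠ 0) (ha : a₀ ≠ 0) (ν : ℤ) (N : ℕ)
    (G : ℤ → ℂ → ℂ)
    (hc1 : ∀ (μ : ℤ) (c : ℂ), G (μ + 1) (q * c) = G μ (q * c) + a₀ ^ 2 * q ^ (2 * μ) * c ^ 2 * G μ c)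
    (hc2 : ∀ (μ : ℤ) (c : ℂ), G (μ + 1) c = G μ (q * c) + c ^ 2 * G μ c)
    (f₀ f₁ f₂ : ℂ → ℂ)
    (hf0 : ∀ c, f₀ c = a₀ * q ^ ν * c ^ 2 * (phiT G (N + 1) ν c * phiT G N ν (q * c)) /
        (phiT G (N + 1) ν (q * c) * phiT G N ν c))
    (hf1 : ∀ c, f₁ c = -(1 / (a₀ * q ^ (ν + (N : ℤ) - 1))) *
        (phiT G (N + 1) ν (q * c) * phiT G N (ν - 1) c) /
        (phiT G (N + 1) ν c * phiT G N (ν - 1) (q * c)))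
    (hf2 : ∀ c, f₂ c = -q ^ (N : ℤ) * (phiT G N (ν - 1) (q * c) * phiT G N ν c) /
        (phiT G N ν (q * c) * phiT G N (ν - 1) c)) :
    ∀ c : ℂ,
      (∀ x ∈ ({c, q * c, q * (q * c)} : Set ℂ),
        phiT G N ν x ≠ 0 ∧ phiT G (N + 1) ν x ≠ 0 ∧ phiT G N (ν - 1) x ≠ 0) →
      1 + a₀ * q ^ ν * f₀ c + q ^ ((N : ℤ) + 1) * f₀ c * f₁ c ≠ 0 →
      1 + q ^ ((N : ℤ) - ν + 1) / a₀ * f₁ c + q ^ (1 - ν) / a₀ * f₁ c * f₂ c ≠ 0 →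
      1 + q ^ (-(N : ℤ)) * f₂ c + a₀ * q ^ (ν - (N : ℤ)) * f₂ c * f₀ c ≠ 0 →
      f₀ (q * c) = q ^ ((N : ℤ) + 1) * f₁ c *
          (1 + q ^ (-(N : ℤ)) * f₂ c + a₀ * q ^ (ν - (N : ℤ)) * f₂ c * f₀ c) /
          (1 + a₀ * q ^ ν * f₀ c + q ^ ((N : ℤ) + 1) * f₀ c * f₁ c) ∧
      f₁ (q * c) = q ^ (1 - ν) / a₀ * f₂ c *
          (1 + a₀ * q ^ ν * f₀ c + q ^ ((N : ℤ) + 1) * f₀ c * f₁ c) /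
          (1 + q ^ ((N : ℤ) - ν + 1) / a₀ * f₁ c + q ^ (1 - ν) / a₀ * f₁ c * f₂ c) ∧
      f₂ (q * c) = a₀ * q ^ (ν - (N : ℤ)) * f₀ c *
          (1 + q ^ ((N : ℤ) - ν + 1) / a₀ * f₁ c + q ^ (1 - ν) / a₀ * f₁ c * f₂ c) /
          (1 + q ^ (-(N : ℤ)) * f₂ c + a₀ * q ^ (ν - (N : ℤ)) * f₂ c * f₀ c) := by
  intro c hφ hD0 hD1 hD2
  have hc : c ≠ 0 := by
    rintro rfl
    obtain ⟨hA, hF, hB⟩ := hφ 0 (by simp)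
    apply hD2
    rw [hf0, hf2]
    simp only [mul_zero, zpow_neg]
    field_simp
    simp
  obtain ⟨hA, hF, hB⟩ := hφ c (by simp)
  obtain ⟨hA₁, hF₁, hB₁⟩ := hφ (q * c) (by simp)
  obtain ⟨hA₂, hF₂, hB₂⟩ := hφ (q * (q * c)) (by simp)
  have hm : q ^ N ≠ 0 := pow_ne_zero N hq
  have hr : q ^ ν ≠ 0 := zpow_ne_zero ν hq
  obtain ⟨hsize, hindex, V, hcorner, hshift⟩ := phiT_bilinear hq ha hc ν N G hc1 hc2
  obtain ⟨h₁, h₃⟩ := bilinear_elimination hm hsize hindex hcorner hshift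
  have z1 : q ^ (ν + (N : ℤ) - 1) = q ^ ν * q ^ N / q := by
    rw [zpow_sub_one₀ hq, zpow_add₀ hq, zpow_natCast]; rfl
  have z2 : q ^ ((N : ℤ) + 1) = q ^ N * q := by rw [zpow_add_one₀ hq, zpow_natCast]
  have z3 : q ^ ((N : ℤ) - ν + 1) = q ^ N / q ^ ν * q := by
    rw [zpow_add_one₀ hq, zpow_sub₀ hq, zpow_natCast]
  have z4 : q ^ (1 - ν) = q / q ^ ν := by rw [zpow_sub₀ hq, zpow_one]
  have z5 : q ^ (-(N : ℤ)) = 1 / q ^ N := by rw [zpow_neg, zpow_natCast, one_div]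
  have z6 : q ^ (ν - (N : ℤ)) = q ^ ν / q ^ N := by rw [zpow_sub₀ hq, zpow_natCast]
  simp only [hf0, hf1, hf2, z1, z2, z3, z4, z5, z6, zpow_natCast] at hD0 hD1 hD2 ⊢
  clear hsize hindex hcorner hshift hφ z1 z2 z3 z4 z5 z6 hf0 hf1 hf2 hc1 hc2
  generalize phiT G N ν c = A at *
  generalize phiT G N ν (q * c) = A₁ at *
  generalize phiT G N ν (q * (q * c)) = A₂ at *
  generalize phiT G N (ν - 1) c = B at *
  generalize phiT G N (ν - 1) (q * c) = B₁ at *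
  generalize phiT G N (ν - 1) (q * (q * c)) = B₂ at *
  generalize phiT G (N + 1) ν c = F at *
  generalize phiT G (N + 1) ν (q * c) = F₁ at *
  generalize phiT G (N + 1) ν (q * (q * c)) = F₂ at *
  generalize q ^ N = m at *
  generalize q ^ ν = r at *
  have e0 : 1 + a₀ * r * (a₀ * r * c ^ 2 * (F * A₁) / (F₁ * A)) +
      m * q * (a₀ * r * c ^ 2 * (F * A₁) / (F₁ * A)) *
        (-(1 / (a₀ * (r * m / q))) * (F₁ * B) / (F * B₁)) =
      (F₁ * (A * B₁ - (q * c) ^ 2 * A₁ * B) + a₀ ^ 2 * r ^ 2 * c ^ 2 * F * A₁ * B₁) /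
        (F₁ * A * B₁) := by
    field_simp
    ring
  have e1 : 1 + m / r * q / a₀ * (-(1 / (a₀ * (r * m / q))) * (F₁ * B) / (F * B₁)) +
      q / r / a₀ * (-(1 / (a₀ * (r * m / q))) * (F₁ * B) / (F * B₁)) *
        (-m * (B₁ * A) / (A₁ * B)) =
      (a₀ ^ 2 * r ^ 2 * c ^ 2 * A₁ * B₁ * F - (q * c) ^ 2 * F₁ * (A₁ * B - A * B₁)) /
        (a₀ ^ 2 * r ^ 2 * c ^ 2 * (F * A₁ * B₁)) := by
    field_simp
    ring
  have e2 : 1 + 1 / m * (-m * (B₁ * A) / (A₁ * B)) +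
      a₀ * (r / m) * (-m * (B₁ * A) / (A₁ * B)) * (a₀ * r * c ^ 2 * (F * A₁) / (F₁ * A)) =
      (F₁ * (A₁ * B - A * B₁) - a₀ ^ 2 * r ^ 2 * c ^ 2 * F * A₁ * B₁) / (F₁ * A₁ * B) := by
    field_simp
    ring
  rw [e0] at hD0 ⊢
  rw [e1] at hD1 ⊢
  rw [e2] at hD2 ⊢
  replace hD0 := (div_ne_zero_iff.1 hD0).1
  replace hD1 := (div_ne_zero_iff.1 hD1).1
  replace hD2 := (div_ne_zero_iff.1 hD2).1
  clear e0 e1 e2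
  generalize F₁ * (A * B₁ - (q * c) ^ 2 * A₁ * B) + a₀ ^ 2 * r ^ 2 * c ^ 2 * F * A₁ * B₁ = T₀ at *
  generalize a₀ ^ 2 * r ^ 2 * c ^ 2 * A₁ * B₁ * F - (q * c) ^ 2 * F₁ * (A₁ * B - A * B₁) = T₁ at *
  generalize F₁ * (A₁ * B - A * B₁) - a₀ ^ 2 * r ^ 2 * c ^ 2 * F * A₁ * B₁ = T₂ at *
  have h₂ : F₂ * B * T₁ = m ^ 2 * (a₀ ^ 2 * r ^ 2 * c ^ 2) * B₂ * F * T₀ := by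
    apply mul_left_cancel₀ hA₂
    linear_combination F₂ * h₃ - m ^ 2 * B₂ * h₁
  refine ⟨?_, ?_, ?_⟩
  · field_simp
    linear_combination h₁
  · field_simp
    linear_combination -h₂
  · field_simp
    linear_combination -h₃

end
end

section
/- Bilinear difference equation (bl1) for the Toeplitz determinants: let q, a₀ ∈ ℂ∖{0} and let G : ℤ × ℂ → ℂ satisfy the contiguity relations. Define φ_M^μ(c) = det(G_{μ-i+j}(c))_{1≤i,j≤M} for M ≥ 1 and φ_0^μ(c) = 1. Then for all N ∈ ℕ, ν ∈ ℤ and c ∈ ℂ: a₀²c²q^{2ν} φ_N^ν(qc) φ_{N+1}^ν(c) + φ_N^ν(c) φ_{N+1}^ν(qc) = q^{-2N} φ_{N+1}^{ν+1}(qc) φ_N^{ν-1}(c). -/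
noncomputable section

namespace Matrix

variable {R : Type*} [CommRing R]

/-- The three-term Plücker relation for the columns of a square matrix. -/
theorem det_mul_det_updateCol_updateCol {n : Type*} [Fintype n] [DecidableEq n]
    (M : Matrix n n R) {p r : n} (hpr : p ≠ r) (x y : n → R) :
    M.det * ((M.updateCol p x).updateCol r y).det =
      (M.updateCol p x).det * (M.updateCol r y).det +
        (M.updateCol r x).det * ((M.updateCol p (M.col r)).updateCol r y).det := by
  have hlin : ∀ z : n → R, ((M.updateCol p z).updateCol r y).det =
      cramer (M.updateCol r y) z p := fun z => by
    rw [cramer_apply, updateCol_comm _ hpr]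
  have hx : M.det • x = ∑ i, cramer M x i • M.col i := by
    rw [← mulVec_cramer]
    ext k
    simp [mulVec, dotProduct, mul_comm]
  have key : M.det * ((M.updateCol p x).updateCol r y).det =
      ∑ i, cramer M x i * ((M.updateCol p (M.col i)).updateCol r y).det := by
    simp only [hlin]
    rw [← smul_eq_mul, ← Pi.smul_apply, ← map_smul, hx]
    simp
  rw [key, Finset.sum_eq_add p r hpr]
  · have : M.updateCol p (M.col p) = M := updateCol_eq_self M p
    simp only [cramer_apply, this]
  · rintro i - ⟨hip, hir⟩
    rw [det_zero_of_column_eq hip fun k => ?_, mul_zero]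
    simp [hip, hir, hpr]
  · simp
  · simp

/-- Replacing a column by a standard basis vector computes a cofactor. -/
theorem det_updateCol_single_one {n : ℕ} (A : Matrix (Fin (n + 1)) (Fin (n + 1)) R)
    (i j : Fin (n + 1)) :
    (A.updateCol j (Pi.single i 1)).det =
      (-1) ^ (i + j : ℕ) * (A.submatrix i.succAbove j.succAbove).det := by
  rw [← cramer_apply, cramer_eq_adjugate_mulVec, mulVec_single_one, col_apply,
    adjugate_fin_succ_eq_det_submatrix]

/-- The `n × n` Toeplitz matrix with entries `a (μ - i + j)`. -/
def toeplitzInt (a : ℤ → R) (n : ℕ) (μ : ℤ) : Matrix (Fin n) (Fin n) R :=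
  of fun i j => a (μ - ((i : ℕ) : ℤ) + ((j : ℕ) : ℤ))

/-- Replacing all columns but the first by successive differences does not change a Toeplitz
determinant. -/
theorem det_updateCol_zero_toeplitzInt_sub (a : ℤ → R) (n : ℕ) (μ : ℤ) :
    ((toeplitzInt (fun k => a (k + 1) - a k) (n + 1) μ).updateCol 0
      fun i => a (μ - ((i : ℕ) : ℤ) + 1)).det = (toeplitzInt a (n + 1) (μ + 1)).det := by
  refine (det_eq_of_forall_col_eq_smul_add_pred (fun _ => 1) (fun i => ?_) fun i j => ?_).symm
  · simp [toeplitzInt, add_sub_right_comm]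
  · simp only [toeplitzInt, of_apply, updateCol_ne (Fin.succ_ne_zero j), Fin.val_succ,
      Fin.val_castSucc, Nat.cast_add, Nat.cast_one]
    ring_nf

/-- The difference form of a Toeplitz determinant, with the first difference column moved to the
end. -/
theorem det_updateCol_last_updateCol_zero_toeplitzInt_sub (a : ℤ → R) (n : ℕ) (μ : ℤ) :
    (((toeplitzInt (fun k => a (k + 1) - a k) (n + 2) μ).updateCol (Fin.last (n + 1))
      ((toeplitzInt (fun k => a (k + 1) - a k) (n + 2) μ).col 0)).updateCol 0
      fun i => a (μ - ((i : ℕ) : ℤ) + 1)).det =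
      (-1) ^ n * (toeplitzInt a (n + 2) μ).det := by
  set T := toeplitzInt a (n + 2) μ with hT
  set P := toeplitzInt (fun k => a (k + 1) - a k) (n + 2) μ with hP
  set Y : Matrix (Fin (n + 2)) (Fin (n + 2)) R := of fun i j =>
    Fin.cases (P i 0) (fun k => Fin.cases (T i 1) (fun l => P i l.succ.castSucc) k) j with hY
  have hrot : ((P.updateCol (Fin.last (n + 1)) (P.col 0)).updateCol 0
      fun i => a (μ - ((i : ℕ) : ℤ) + 1)) = Y.submatrix id (finRotate (n + 2)) := by
    ext i j
    rw [submatrix_apply, finRotate_apply, id]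
    induction j using Fin.lastCases with
    | last => simp [hY]
    | cast k =>
      rw [Fin.coeSucc_eq_succ]
      induction k using Fin.cases with
      | zero => simp [hY, hT, toeplitzInt, -Fin.succ_zero_eq_one, -Fin.succ_zero_eq_one']
      | succ l => simp [hY, Fin.ext_iff, l.isLt.ne]
  have hneg : (T.updateCol 0 fun i => T i 0 + (-1 : R) • T i 1).det =
      (Y.updateCol 0 ((-1 : R) • Y.col 0)).det := by
    refine det_eq_of_forall_col_eq_smul_add_pred (Fin.cases 0 fun _ => 1)
      (fun i => ?_) fun i j => ?_
    · simp [hY, hP, hT, toeplitzInt, sub_eq_add_neg]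
    · induction j using Fin.cases with
      | zero =>
        simp [hY, -Fin.succ_zero_eq_one, -Fin.succ_zero_eq_one']
        rfl
      | succ l =>
        simp [hY, hP, hT, toeplitzInt, Fin.ext_iff, add_assoc]
  rw [det_updateCol_add_smul_self _ (by simp), det_updateCol_smul] at hneg
  have hself : Y.updateCol 0 (Y.col 0) = Y := updateCol_eq_self Y 0
  rw [hself] at hneg
  rw [hrot, det_permute', sign_finRotate, hneg]
  simp [pow_succ]

/-- A bilinear identity between the Toeplitz determinants of a sequence and those of its
difference sequence. -/
theorem det_toeplitzInt_sub_bilinear (a : ℤ → R) (n : ℕ) (μ : ℤ) :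
    (toeplitzInt (fun k => a (k + 1) - a k) (n + 2) μ).det * (toeplitzInt a (n + 1) μ).det +
        (toeplitzInt (fun k => a (k + 1) - a k) (n + 1) μ).det * (toeplitzInt a (n + 2) μ).det =
      (toeplitzInt (fun k => a (k + 1) - a k) (n + 1) (μ - 1)).det *
        (toeplitzInt a (n + 2) (μ + 1)).det := by
  set b : ℤ → R := fun k => a (k + 1) - a k with hb
  have plucker := det_mul_det_updateCol_updateCol (toeplitzInt b (n + 2) μ)
    (Fin.last_pos.ne' : Fin.last (n + 1) ≠ 0) (Pi.single 0 1)
    (fun i => a (μ - ((i : ℕ) : ℤ) + 1))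
  have hcorner : (((toeplitzInt b (n + 2) μ).updateCol (Fin.last (n + 1))
      (Pi.single 0 1)).updateCol 0 fun i => a (μ - ((i : ℕ) : ℤ) + 1)).det =
      (-1) ^ (n + 1) * (toeplitzInt a (n + 1) μ).det := by
    have h := det_updateCol_zero_toeplitzInt_sub a n (μ - 1)
    rw [sub_add_cancel] at h
    rw [updateCol_comm _ Fin.last_pos.ne', det_updateCol_single_one, ← h]
    simp only [Fin.val_zero, Fin.val_last, zero_add]
    congr 2
    ext i j
    induction j using Fin.cases with
    | zero => simp [sub_sub, add_comm]
    | succ k =>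
      simp [toeplitzInt, Fin.ext_iff, hb, sub_sub, add_comm]
  have hlast : ((toeplitzInt b (n + 2) μ).updateCol (Fin.last (n + 1)) (Pi.single 0 1)).det =
      (-1) ^ (n + 1) * (toeplitzInt b (n + 1) (μ - 1)).det := by
    rw [det_updateCol_single_one]
    simp only [Fin.val_zero, Fin.val_last, zero_add]
    congr 2
    ext i j
    simp [toeplitzInt, sub_sub, add_comm]
  have hzero : ((toeplitzInt b (n + 2) μ).updateCol 0 (Pi.single 0 1)).det =
      (toeplitzInt b (n + 1) μ).det := by
    rw [det_updateCol_single_one]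
    simp only [Fin.val_zero, add_zero, pow_zero, one_mul]
    congr 1
    ext i j
    simp only [toeplitzInt, submatrix_apply, of_apply, Fin.zero_succAbove, Fin.val_succ]
    congr 1
    push_cast
    ring
  rw [hcorner, hlast, hzero, det_updateCol_zero_toeplitzInt_sub,
    det_updateCol_last_updateCol_zero_toeplitzInt_sub] at plucker
  have hsq : ((-1 : R) ^ n) * (-1) ^ n = 1 := by rw [← mul_pow]; simp
  linear_combination (-(-1 : R) ^ n) * plucker +
    (-(toeplitzInt b (n + 2) μ).det * (toeplitzInt a (n + 1) μ).det -
      (toeplitzInt b (n + 1) μ).det * (toeplitzInt a (n + 2) μ).det +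
      (toeplitzInt b (n + 1) (μ - 1)).det * (toeplitzInt a (n + 2) (μ + 1)).det) * hsq

/-- Twisting the entries of a Toeplitz matrix by a geometric sequence rescales its determinant. -/
theorem det_toeplitzInt_geom_mul {K : Type*} [Field K] {r : K} (hr : r ≠ 0) (t : K) (b : ℤ → K)
    (n : ℕ) (μ : ℤ) :
    (toeplitzInt (fun k => t * r ^ k * b k) n μ).det =
      (t * r ^ μ) ^ n * (toeplitzInt b n μ).det := by
  have h : toeplitzInt (fun k => t * r ^ k * b k) n μ =
      of fun i j : Fin n => (t * r ^ μ * (r ^ (i : ℕ))⁻¹) *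
        (of fun i j : Fin n => r ^ (j : ℕ) * toeplitzInt b n μ i j) i j := by
    ext i j
    simp only [toeplitzInt, of_apply, zpow_add₀ hr, zpow_sub₀ hr, zpow_natCast]
    ring
  rw [h, det_mul_column, det_mul_row, Finset.prod_mul_distrib, Finset.prod_inv_distrib]
  have hprod : ∏ i : Fin n, r ^ (i : ℕ) ≠ 0 :=
    Finset.prod_ne_zero_iff.2 fun i _ => pow_ne_zero _ hr
  simp only [Finset.prod_const, Finset.card_univ, Fintype.card_fin]
  field_simp

end Matrix

/-- The bilinear difference equation (bl1) for the Toeplitz determinants. -/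
theorem qPIV_bilinear_bl1 (q a₀ : ℂ) (hq : q ≠ 0) (ha : a₀ ≠ 0)
    (G : ℤ → ℂ → ℂ)
    (hc1 : ∀ (μ : ℤ) (c : ℂ), G (μ + 1) (q * c) = G μ (q * c) + a₀ ^ 2 * q ^ (2 * μ) * c ^ 2 * G μ c)
    (hc2 : ∀ (μ : ℤ) (c : ℂ), G (μ + 1) c = G μ (q * c) + c ^ 2 * G μ c) :
    ∀ (N : ℕ) (ν : ℤ) (c : ℂ),
      a₀ ^ 2 * c ^ 2 * q ^ (2 * ν) * phiT G N ν (q * c) * phiT G (N + 1) ν c +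
        phiT G N ν c * phiT G (N + 1) ν (q * c) =
      q ^ (-(2 * (N : ℤ))) * phiT G (N + 1) (ν + 1) (q * c) * phiT G N (ν - 1) c := by
  intro N ν c
  obtain _ | n := N
  · have h := hc1 ν c
    simp [phiT]
    linear_combination -h
  · have hphi : ∀ M μ x, phiT G M μ x = (Matrix.toeplitzInt (fun k => G k x) M μ).det :=
      fun _ _ _ => rfl
    by_cases hc : c = 0
    · have hconst : ∀ μ, phiT G (n + 2) μ (q * c) = 0 := fun μ => by
        refine Matrix.det_zero_of_column_eq (i := 0) (j := 1) (by simp) fun k => ?_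
        have h := hc1 (μ - ((k : ℕ) : ℤ)) c
        simp_all
      rw [hconst, hconst, hc]
      ring
    · set t := a₀ ^ 2 * c ^ 2 with ht
      have ht0 : t ≠ 0 := by positivity
      have hq2 : q ^ 2 ≠ 0 := pow_ne_zero 2 hq
      have hdiff : (fun k => G (k + 1) (q * c) - G k (q * c)) =
          fun k => t * (q ^ 2) ^ k * G k c := by
        funext k
        have hqk : (q ^ 2) ^ k = q ^ (2 * k) := by rw [zpow_mul]; norm_cast
        rw [hc1, hqk]
        ring
      have key := Matrix.det_toeplitzInt_sub_bilinear (fun k => G k (q * c)) n ν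
      simp only [hdiff, Matrix.det_toeplitzInt_geom_mul hq2, ← hphi] at key
      have hqν : q ^ (2 * ν) = (q ^ 2) ^ ν := by rw [zpow_mul]; norm_cast
      have hqN : q ^ (-(2 * ((n + 1 : ℕ) : ℤ))) = ((q ^ 2) ^ (n + 1))⁻¹ := by
        rw [zpow_neg, zpow_mul]; norm_cast
      have hs : t * (q ^ 2) ^ ν ≠ 0 := mul_ne_zero ht0 (zpow_ne_zero _ hq2)
      rw [zpow_sub_one₀ hq2, ← mul_assoc, mul_pow _ (q ^ 2)⁻¹, inv_pow] at key
      rw [hqν, hqN]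
      apply mul_left_cancel₀ (pow_ne_zero (n + 1) hs)
      linear_combination key
end
end

section
/- Bilinear difference equation (bl3) for the Toeplitz determinants: let q, a₀ ∈ ℂ∖{0} and let G : ℤ × ℂ → ℂ satisfy the contiguity relations. Define φ_M^μ(c) = det(G_{μ-i+j}(c))_{1≤i,j≤M} for M ≥ 1 and φ_0^μ(c) = 1. Then for all integers N ≥ 1, ν ∈ ℤ and c ∈ ℂ: φ_N^{ν+1}(qc) φ_N^ν(c) - φ_N^{ν+1}(c) φ_N^ν(qc) = -φ_{N-1}^ν(qc) φ_{N+1}^{ν+1}(c). -/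
noncomputable section

/-- The three-term Plücker relation for determinants sharing all columns but two. -/
theorem det_mul_det_updateCol_updateCol {n R : Type*} [Fintype n] [DecidableEq n] [CommRing R]
    (A : Matrix n n R) {p r : n} (hpr : p ≠ r) (e w : n → R) :
    A.det * ((A.updateCol r w).updateCol p e).det =
      (A.updateCol p e).det * (A.updateCol r w).det -
        (A.updateCol r e).det * (A.updateCol p w).det := by
  set B := A.updateCol r w with hB
  set v := A.cramer e with hv
  have hw : B.cramer w p = 0 := by
    rw [Matrix.cramer_apply]
    refine Matrix.det_zero_of_column_eq hpr fun i => ?_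
    simp [hB, hpr.symm]
  have hc : B.cramer (fun i => A i r) p = -(A.updateCol p w).det := by
    have hswap : B.updateCol p (fun i => A i r) =
        (A.updateCol p w).submatrix id (Equiv.swap p r) := by
      ext i j
      rcases eq_or_ne j p with rfl | hp
      · simp [hpr.symm]
      rcases eq_or_ne j r with rfl | hr
      · simp [hB, hp]
      · simp [hB, hp, hr, Equiv.swap_apply_of_ne_of_ne hp hr]
    rw [Matrix.cramer_apply, hswap, Matrix.det_permute', Equiv.Perm.sign_swap hpr]
    simp
  have hA : A.det • e = B.mulVec v + v r • ((fun i => A i r) - w) := by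
    rw [← Matrix.mulVec_cramer]
    ext i
    have hterm : ∀ x, A i x * v x =
        B i x * v x + if x = r then v r * (A i r - w i) else 0 := by
      intro x
      split_ifs with hx
      · subst hx
        simp [hB]
        ring
      · simp [hB, hx]
    change ∑ x, A i x * v x = ∑ x, B i x * v x + v r * (A i r - w i)
    simp [Finset.sum_congr rfl fun x _ => hterm x, Finset.sum_add_distrib]
  have hBv : B.cramer (B.mulVec v) p = B.det * v p := by
    rw [Matrix.cramer_eq_adjugate_mulVec, Matrix.mulVec_mulVec, Matrix.adjugate_mul]
    simp [Matrix.smul_mulVec]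
  have h := congrFun (congrArg B.cramer hA) p
  simp only [map_smul, map_add, map_sub, Pi.add_apply, Pi.smul_apply, Pi.sub_apply, smul_eq_mul,
    hBv, hw, hc] at h
  rw [← Matrix.cramer_apply B, h, hv, Matrix.cramer_apply, Matrix.cramer_apply]
  ring

/-- Replacing column `k` by the `i`-th basis vector gives the signed `(i, k)` minor. -/
theorem det_updateCol_single {R : Type*} [CommRing R] {n : ℕ}
    (A : Matrix (Fin (n + 1)) (Fin (n + 1)) R) (i k : Fin (n + 1)) :
    (A.updateCol k (Pi.single i 1)).det =
      (-1) ^ (i + k : ℕ) * (A.submatrix i.succAbove k.succAbove).det := by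
  rw [← Matrix.adjugate_fin_succ_eq_det_submatrix, ← Matrix.cramer_apply,
    Matrix.cramer_eq_adjugate_mulVec, Matrix.mulVec_single_one, Matrix.col_apply]

/-- A determinant with a column of descending powers of `t` collapses, under the row operations
`Rᵢ ↦ Rᵢ - t Rᵢ₊₁`, to a determinant of one size less. -/
theorem det_updateCol_pow {R : Type*} [CommRing R] {n : ℕ}
    (A : Matrix (Fin (n + 1)) (Fin (n + 1)) R) (k : Fin (n + 1)) (t : R) :
    (A.updateCol k fun i => t ^ (i.rev : ℕ)).det =
      (-1) ^ (n + k : ℕ) * (Matrix.of fun i j : Fin n =>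
        A i.castSucc (k.succAbove j) - t * A i.succ (k.succAbove j)).det := by
  set C := A.updateCol k fun i => t ^ (i.rev : ℕ) with hC
  let B : Matrix (Fin (n + 1)) (Fin (n + 1)) R :=
    Matrix.of (Fin.lastCases (C (Fin.last n)) fun i => C i.castSucc - t • C i.succ)
  have hCB : C.det = B.det := by
    rw [← Matrix.det_submatrix_equiv_self Fin.revPerm C,
      ← Matrix.det_submatrix_equiv_self Fin.revPerm B]
    refine Matrix.det_eq_of_forall_row_eq_smul_add_pred (fun _ => t) (fun j => ?_) fun i j => ?_
    · simp [B]
    · simp [B, Fin.rev_succ, Fin.rev_castSucc]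
  have hB : B = B.updateCol k (Pi.single (Fin.last n) 1) := by
    ext i j
    by_cases hj : j = k
    · subst hj
      induction i using Fin.lastCases with
      | last => simp [B, hC]
      | cast i =>
        have hi : (i.castSucc.rev : ℕ) = i.succ.rev + 1 := by
          simp only [Fin.val_rev, Fin.val_castSucc, Fin.val_succ]
          omega
        simp [B, hC, -Fin.val_rev, hi, pow_succ']
    · simp [hj]
  rw [hCB, hB, det_updateCol_single]
  congr 2
  ext i j
  simp [B, hC]

/-- The bilinear difference equation (bl3) for the Toeplitz determinants. -/
theorem qPIV_bilinear_bl3 (q a₀ : ℂ) (hq : q ≠ 0) (ha : a₀ ≠ 0)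
    (G : ℤ → ℂ → ℂ)
    (hc1 : ∀ (μ : ℤ) (c : ℂ), G (μ + 1) (q * c) = G μ (q * c) + a₀ ^ 2 * q ^ (2 * μ) * c ^ 2 * G μ c)
    (hc2 : ∀ (μ : ℤ) (c : ℂ), G (μ + 1) c = G μ (q * c) + c ^ 2 * G μ c) :
    ∀ (N : ℕ), 1 ≤ N → ∀ (ν : ℤ) (c : ℂ),
      phiT G N (ν + 1) (q * c) * phiT G N ν c - phiT G N (ν + 1) c * phiT G N ν (q * c) =
      -(phiT G (N - 1) ν (q * c) * phiT G (N + 1) (ν + 1) c) := by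
  intro N hN ν c
  obtain ⟨m, rfl⟩ : ∃ m, N = m + 1 := ⟨N - 1, by omega⟩
  have hG : ∀ μ, G μ (q * c) = G (μ + 1) c - c ^ 2 * G μ c := fun μ => by rw [hc2]; ring
  let A : Matrix (Fin (m + 2)) (Fin (m + 2)) ℂ :=
    Matrix.of fun i j => G (ν + 1 - ((i : ℕ) : ℤ) + ((j : ℕ) : ℤ)) c
  let w : Fin (m + 2) → ℂ := fun i => (c ^ 2) ^ (i.rev : ℕ)
  have h := det_mul_det_updateCol_updateCol A (Fin.last_pos.ne : 0 ≠ Fin.last (m + 1))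
    (Pi.single 0 1) w
  have hA : A.det = phiT G (m + 2) (ν + 1) c := rfl
  have hcorner : ((A.updateCol (Fin.last (m + 1)) w).updateCol 0 (Pi.single 0 1)).det =
      phiT G m ν (q * c) := by
    have hsub : (A.updateCol (Fin.last (m + 1)) w).submatrix Fin.succ Fin.succ =
        (A.submatrix Fin.succ Fin.succ).updateCol (Fin.last m)
          fun i => (c ^ 2) ^ (i.rev : ℕ) := by
      ext i j
      simp [w, Matrix.updateCol_apply, Fin.succ_eq_last_succ]
    rw [det_updateCol_single, Fin.succAbove_zero, hsub, det_updateCol_pow, phiT, Fin.val_last,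
      Even.neg_one_pow ⟨m, rfl⟩, one_mul, Fin.val_zero, pow_zero, one_mul]
    congr 1
    ext i j
    simp [hG, A]
    ring_nf
  have he₀ : (A.updateCol 0 (Pi.single 0 1)).det = phiT G (m + 1) (ν + 1) c := by
    rw [det_updateCol_single]
    rw [phiT, Fin.val_zero, pow_zero, one_mul]
    congr 1
    ext i j
    simp [A]
    ring_nf
  have he₁ : (A.updateCol (Fin.last (m + 1)) (Pi.single 0 1)).det =
      (-1) ^ (m + 1) * phiT G (m + 1) ν c := by
    rw [det_updateCol_single]
    rw [phiT, Fin.val_zero, zero_add, Fin.val_last]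
    congr 2
    ext i j
    simp [A]
  have hw₀ : (A.updateCol 0 w).det = (-1) ^ (m + 1) * phiT G (m + 1) (ν + 1) (q * c) := by
    rw [det_updateCol_pow]
    rw [phiT, Fin.val_zero, add_zero]
    congr 2
    ext i j
    simp [hG, A]
    ring_nf
  have hw₁ : (A.updateCol (Fin.last (m + 1)) w).det = phiT G (m + 1) ν (q * c) := by
    rw [det_updateCol_pow, phiT, Fin.val_last, Even.neg_one_pow ⟨m + 1, rfl⟩, one_mul]
    congr 1
    ext i j
    simp [hG, A]
    ring_nf
  rw [hA, hcorner, he₀, he₁, hw₀, hw₁] at h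
  have hsign : ((-1 : ℂ) ^ (m + 1)) * (-1) ^ (m + 1) = 1 := by
    rw [← mul_pow]; simp
  rw [Nat.add_sub_cancel]
  linear_combination h - phiT G (m + 1) ν c * phiT G (m + 1) (ν + 1) (q * c) * hsign


end
end

section
/- Ultra-discrete qP_IV and its affine Weyl group symmetry (Proposition): work over ℝ with A = (A₀,A₁,A₂) and F = (F₀,F₁,F₂), indices in ℤ/3ℤ. Define the ultra-discrete time evolution t by t(A_j) = A_j and t(F_j) = A_j + A_{j+1} + F_{j+1} + max(0, A_{j+2}+F_{j+2}, A_j+A_{j+2}+F_j+F_{j+2}) - max(0, A_j+F_j, A_j+A_{j+1}+F_j+F_{j+1}); define s_i by s_i(A_j) = A_j - a_{ij}A_i and s_i(F_j) = F_j + u_{ij}(max(A_i, F_i) - max(0, A_i+F_i)); define π by π(A_j) = A_{j+1}, π(F_j) = F_{j+1}. Then for all (A,F) ∈ ℝ³ × ℝ³ and all i ∈ ℤ/3ℤ: (i) s_i(s_i(A,F)) = (A,F); (ii) s_i(s_{i+1}(s_i(A,F))) = s_{i+1}(s_i(s_{i+1}(A,F))); (iii) s_i(π(A,F)) = π(s_{i+1}(A,F));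 (iv) t(s_i(A,F)) = s_i(t(A,F)); and (v) t(π(A,F)) = π(t(A,F)). -/
noncomputable section

/-- The ultra-discrete time evolution `t` of uP_IV. -/
def udT (p : (ZMod 3 → ℝ) × (ZMod 3 → ℝ)) : (ZMod 3 → ℝ) × (ZMod 3 → ℝ) :=
  (p.1, fun j =>
    p.1 j + p.1 (j + 1) + p.2 (j + 1)
      + max 0 (max (p.1 (j + 2) + p.2 (j + 2)) (p.1 j + p.1 (j + 2) + p.2 j + p.2 (j + 2)))
      - max 0 (max (p.1 j + p.2 j) (p.1 j + p.1 (j + 1) + p.2 j + p.2 (j + 1))))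

/-- The ultra-discrete Bäcklund transformation `sᵢ`. -/
def udS (i : ZMod 3) (p : (ZMod 3 → ℝ) × (ZMod 3 → ℝ)) : (ZMod 3 → ℝ) × (ZMod 3 → ℝ) :=
  (fun j => p.1 j - (cartanA2 i j : ℝ) * p.1 i,
   fun j => p.2 j + (orientA2 i j : ℝ) * (max (p.1 i) (p.2 i) - max 0 (p.1 i + p.2 i)))

/-- The ultra-discrete diagram rotation `π`. -/
def udPi (p : (ZMod 3 → ℝ) × (ZMod 3 → ℝ)) : (ZMod 3 → ℝ) × (ZMod 3 → ℝ) :=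
  (fun j => p.1 (j + 1), fun j => p.2 (j + 1))

theorem ZMod.three_forall_iff (i : ZMod 3) {P : ZMod 3 → Prop} :
    (∀ j, P j) ↔ P i ∧ P (i + 1) ∧ P (i + 2) := by
  refine ⟨fun h => ⟨h _, h _, h _⟩, fun ⟨h₀, h₁, h₂⟩ j => ?_⟩
  have hj : ∀ i j : ZMod 3, j = i ∨ j = i + 1 ∨ j = i + 2 := by decide
  rcases hj i j with rfl | rfl | rfl <;> assumption

theorem cartanA2_self (i : ZMod 3) : cartanA2 i i = 2 := by decide +revert
theorem cartanA2_add_right (i j k : ZMod 3) : cartanA2 (i + k) (j + k) = cartanA2 i j := by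
  decide +revert
theorem orientA2_add_right (i j k : ZMod 3) : orientA2 (i + k) (j + k) = orientA2 i j := by
  decide +revert

theorem udS_udPi (i : ZMod 3) (p : (ZMod 3 → ℝ) × (ZMod 3 → ℝ)) :
    udS i (udPi p) = udPi (udS (i + 1) p) := by
  simp only [udS, udPi, cartanA2_add_right, orientA2_add_right]

theorem udT_udPi (p : (ZMod 3 → ℝ) × (ZMod 3 → ℝ)) : udT (udPi p) = udPi (udT p) := by
  simp only [udT, udPi, add_right_comm _ (2 : ZMod 3) 1]

/-- The amount by which `sᵢ` shifts the neighbours of `Fᵢ = f`, where `Aᵢ = a`. -/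
def udShift (a f : ℝ) : ℝ := max a f - max 0 (a + f)

theorem udShift_neg (a f : ℝ) : udShift (-a) f = -udShift a f := by
  grind [udShift]

theorem udShift_braid_left (a b x y : ℝ) :
    udShift (a + b) (y + udShift a x) =
      udShift b y + udShift a (y + udShift (a + b) (x - udShift b y)) := by
  unfold udShift
  grind

theorem udShift_braid_right (a b x y : ℝ) :
    udShift (a + b) (x - udShift b y) =
      udShift a x + udShift b (x - udShift (a + b) (y + udShift a x)) := by
  unfold udShift
  grind

/-- The maximum `max (0, Aⱼ + Fⱼ, Aⱼ + Aⱼ₊₁ + Fⱼ + Fⱼ₊₁)` occurring in the time evolution,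
with `(a, b) = (Aⱼ, Aⱼ₊₁)` and `(x, y) = (Fⱼ, Fⱼ₊₁)`. -/
def udMax (a b x y : ℝ) : ℝ := max 0 (max (a + x) (a + b + x + y))

theorem udMax_reflect (a b c x y z : ℝ) :
    b + (y + udShift a x) + udMax (a + c) (-a) (z - udShift a x) x
        - udMax (-a) (a + b) x (y + udShift a x) =
      a + b + y + udMax c a z x - udMax a b x y := by
  unfold udShift udMax
  grind

theorem udMax_reflect_succ (a b c x y z : ℝ) :
    (a + b) + (a + c) + (z - udShift a x) + udMax (-a) (a + b) x (y + udShift a x)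
        - udMax (a + b) (a + c) (y + udShift a x) (z - udShift a x) =
      b + c + z + udMax a b x y - udMax b c y z
        + udShift a (a + b + y + udMax c a z x - udMax a b x y) := by
  unfold udShift udMax
  grind (splits := 16)

theorem udT_snd_apply (p : (ZMod 3 → ℝ) × (ZMod 3 → ℝ)) (j : ZMod 3) :
    (udT p).2 j = p.1 j + p.1 (j + 1) + p.2 (j + 1)
      + udMax (p.1 (j + 2)) (p.1 j) (p.2 (j + 2)) (p.2 j)
      - udMax (p.1 j) (p.1 (j + 1)) (p.2 j) (p.2 (j + 1)) := by
  simp only [udT, udMax]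
  ring_nf

theorem udS_snd_apply (i : ZMod 3) (p : (ZMod 3 → ℝ) × (ZMod 3 → ℝ)) (j : ZMod 3) :
    (udS i p).2 j = p.2 j + (orientA2 i j : ℝ) * udShift (p.1 i) (p.2 i) := rfl

theorem udS_fst_apply (i : ZMod 3) (p : (ZMod 3 → ℝ) × (ZMod 3 → ℝ)) (j : ZMod 3) :
    (udS i p).1 j = p.1 j - (cartanA2 i j : ℝ) * p.1 i := rfl

theorem udS_fst_self (i : ZMod 3) (p : (ZMod 3 → ℝ) × (ZMod 3 → ℝ)) :
    (udS i p).1 i = -p.1 i := by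
  rw [udS_fst_apply, cartanA2_self]
  push_cast
  ring

theorem udS_fst_of_ne {i j : ZMod 3} (h : i ≠ j) (p : (ZMod 3 → ℝ) × (ZMod 3 → ℝ)) :
    (udS i p).1 j = p.1 i + p.1 j := by
  rw [udS_fst_apply, cartanA2, if_neg h]
  push_cast
  ring

theorem udS_snd_self (i : ZMod 3) (p : (ZMod 3 → ℝ) × (ZMod 3 → ℝ)) :
    (udS i p).2 i = p.2 i := by
  simp [udS_snd_apply, orientA2]

theorem udS_snd_of_eq_add_one {i j : ZMod 3} (h : j = i + 1)
    (p : (ZMod 3 → ℝ) × (ZMod 3 → ℝ)) :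
    (udS i p).2 j = p.2 j + udShift (p.1 i) (p.2 i) := by
  simp [udS_snd_apply, orientA2, h]

theorem udS_snd_of_eq_add_two {i j : ZMod 3} (h : j = i + 2)
    (p : (ZMod 3 → ℝ) × (ZMod 3 → ℝ)) :
    (udS i p).2 j = p.2 j - udShift (p.1 i) (p.2 i) := by
  have hij : orientA2 i (i + 2) = -1 := by decide +revert
  simp [udS_snd_apply, h, hij, sub_eq_add_neg]

theorem udS_udS (i : ZMod 3) (p : (ZMod 3 → ℝ) × (ZMod 3 → ℝ)) : udS i (udS i p) = p := by
  refine Prod.ext (funext fun j => ?_) (funext fun j => ?_)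
  · rw [udS_fst_apply, udS_fst_self, udS_fst_apply]
    ring
  · rw [udS_snd_apply, udS_snd_self, udS_fst_self, udShift_neg, udS_snd_apply]
    ring

theorem udS_braid (i : ZMod 3) (p : (ZMod 3 → ℝ) × (ZMod 3 → ℝ)) :
    udS i (udS (i + 1) (udS i p)) = udS (i + 1) (udS i (udS (i + 1) p)) := by
  have h₀₁ : i ≠ i + 1 := by decide +revert
  have h₀₂ : i ≠ i + 2 := by decide +revert
  have h₁₂ : i + 1 ≠ i + 2 := by decide +revert
  have h₁ : i + 2 = i + 1 + 1 := by decide +revert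
  have h₂ : i = i + 1 + 2 := by decide +revert
  have hl := udShift_braid_left (p.1 i) (p.1 (i + 1)) (p.2 i) (p.2 (i + 1))
  have hr := udShift_braid_right (p.1 i) (p.1 (i + 1)) (p.2 i) (p.2 (i + 1))
  refine Prod.ext (funext ?_) (funext ?_) <;> rw [ZMod.three_forall_iff i] <;>
    simp only [udS_fst_self, udS_fst_of_ne h₀₁, udS_fst_of_ne h₀₁.symm, udS_fst_of_ne h₀₂,
      udS_fst_of_ne h₁₂, udS_snd_self, udS_snd_of_eq_add_one (rfl : i + 1 = i + 1),
      udS_snd_of_eq_add_two (rfl : i + 2 = i + 2), udS_snd_of_eq_add_one h₁,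
      udS_snd_of_eq_add_two h₂, add_comm (p.1 (i + 1)) (p.1 i),
      add_neg_cancel_comm, add_neg_cancel_right]
  · refine ⟨?_, ?_, ?_⟩ <;> ring
  · refine ⟨?_, ?_, ?_⟩ <;> linarith

theorem udT_udS (i : ZMod 3) (p : (ZMod 3 → ℝ) × (ZMod 3 → ℝ)) :
    udT (udS i p) = udS i (udT p) := by
  have h₀₁ : i ≠ i + 1 := by decide +revert
  have h₀₂ : i ≠ i + 2 := by decide +revert
  have h₁₁ : i + 1 + 1 = i + 2 := by decide +revert
  have h₁₂ : i + 1 + 2 = i := by decide +revert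
  have h₂₁ : i + 2 + 1 = i := by decide +revert
  have h₂₂ : i + 2 + 2 = i + 1 := by decide +revert
  have h := udMax_reflect (p.1 i) (p.1 (i + 1)) (p.1 (i + 2)) (p.2 i) (p.2 (i + 1)) (p.2 (i + 2))
  have h' := udMax_reflect_succ (p.1 i) (p.1 (i + 1)) (p.1 (i + 2))
    (p.2 i) (p.2 (i + 1)) (p.2 (i + 2))
  refine Prod.ext rfl (funext ?_)
  rw [ZMod.three_forall_iff i]
  simp only [udS_snd_self, udS_snd_of_eq_add_one (rfl : i + 1 = i + 1),
    udS_snd_of_eq_add_two (rfl : i + 2 = i + 2), udT_snd_apply, h₁₁, h₁₂, h₂₁, h₂₂,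
    udS_fst_self, udS_fst_of_ne h₀₁, udS_fst_of_ne h₀₂, show (udT p).1 = p.1 from rfl]
  refine ⟨?_, ?_, ?_⟩ <;> linarith

/-- The ultra-discrete Bäcklund transformations generate the extended affine Weyl group of
type `A₂⁽¹⁾` and commute with the ultra-discrete time evolution of uP_IV. -/
theorem uPIV_Weyl_symmetry :
    ∀ (A F : ZMod 3 → ℝ) (i : ZMod 3),
      udS i (udS i (A, F)) = (A, F) ∧
      udS i (udS (i + 1) (udS i (A, F))) = udS (i + 1) (udS i (udS (i + 1) (A, F))) ∧
      udS i (udPi (A, F)) = udPi (udS (i + 1) (A, F)) ∧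
      udT (udS i (A, F)) = udS i (udT (A, F)) ∧
      udT (udPi (A, F)) = udPi (udT (A, F)) := by
  exact fun A F i => ⟨udS_udS i _, udS_braid i _, udS_udPi i _, udT_udS i _, udT_udPi _⟩

end
end
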